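/- arXiv:1701.00354 — 3 statements merged into one kernel-verified Lean document; each statement's English description precedes it below -/
import Mathlib

section
/- Let (Ω, 𝒜, ℙ) be a probability space and let S, T : Ω → Ω be commuting measure-preserving maps whose joint ℕ²-action is ergodic. Let 𝒜₁, 𝒜₂ be the sub-σ-algebras of S-invariant and T-invariant sets respectively. Suppose g : Ω → ℝ is measurable, there exists λ ≥ 1 with λ⁻¹ ≤ g ≤ λ ℙ-a.e., and g is doubly stochastic with respect to 𝒜₁ and 𝒜₂, i.e. the conditional expectations satisfy 𝔼(g | 𝒜₁) = 𝔼(g | 𝒜₂) = 1 ℙ-a.e. Then for ℙ-almost every ω, lim_{n→∞} per(□_n g(ω)) = 1. -/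
open MeasureTheory Filter

noncomputable section

/-- The permanent of an `n × n` real matrix. -/
def permanent {n : ℕ} (M : Matrix (Fin n) (Fin n) ℝ) : ℝ :=
  ∑ π : Equiv.Perm (Fin n), ∏ i, M i (π i)

/-- The permanental mean `per(M) = (perm(M)/n!)^{1/n}`. -/
def permMean {n : ℕ} (M : Matrix (Fin n) (Fin n) ℝ) : ℝ :=
  (permanent M / (Nat.factorial n)) ^ ((n : ℝ)⁻¹)

/-- The sub-σ-algebra of `S`-invariant (measurable) sets. -/
def invSigma {Ω : Type*} [MeasurableSpace Ω] (S : Ω → Ω) : MeasurableSpace Ω where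
  MeasurableSet' A := MeasurableSet A ∧ S ⁻¹' A = A
  measurableSet_empty := ⟨MeasurableSet.empty, rfl⟩
  measurableSet_compl A hA := ⟨hA.1.compl, by rw [Set.preimage_compl, hA.2]⟩
  measurableSet_iUnion f hf := ⟨MeasurableSet.iUnion fun i => (hf i).1, by
    rw [Set.preimage_iUnion]
    exact Set.iUnion_congr fun i => (hf i).2⟩

lemma sum_perm_prod_div_tail_sum (n : ℕ) (M : Matrix (Fin n) (Fin n) ℝ)
    (hM : ∀ i j, 0 < M i j) :
    ∑ σ : Equiv.Perm (Fin n),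
      ∏ i, (M i (σ i) / ∑ k, if i ≤ k then M i (σ k) else 0) = 1 := by
  induction n with
  | zero => simp
  | succ n ih =>
    rw [← Equiv.Perm.decomposeFin.symm.sum_comp, Fintype.sum_prod_type]
    have hpos : 0 < ∑ k, M 0 k := Finset.sum_pos (fun k _ => hM 0 k) Finset.univ_nonempty
    have key : ∀ p : Fin (n + 1), ∑ e : Equiv.Perm (Fin n),
        ∏ i, (M i (Equiv.Perm.decomposeFin.symm (p, e) i) /
          ∑ k, if i ≤ k then M i (Equiv.Perm.decomposeFin.symm (p, e) k) else 0)
        = M 0 p / ∑ k, M 0 k := by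
      intro p
      have h := ih (fun i j => M i.succ (Equiv.swap 0 p j.succ)) (fun i j => hM _ _)
      rw [← mul_one (M 0 p / _), ← h, Finset.mul_sum]
      refine Finset.sum_congr rfl fun e _ => ?_
      rw [Fin.prod_univ_succ]
      congr 1
      · simp only [Fin.zero_le, if_true, Equiv.Perm.decomposeFin_symm_apply_zero]
        rw [Equiv.sum_comp (Equiv.Perm.decomposeFin.symm (p, e)) (fun k => M 0 k)]
      · refine Finset.prod_congr rfl fun i _ => ?_
        rw [Fin.sum_univ_succ]
        simp
    simp_rw [key]
    rw [← Finset.sum_div, div_self hpos.ne']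

lemma sum_perm_prod_div_label_sum_le (n K : ℕ) (M : Matrix (Fin n) (Fin n) ℝ)
    (hM : ∀ i j, 0 < M i j) (θ : Fin n → Fin K) :
    ∑ σ : Equiv.Perm (Fin n),
      ∏ i, (M i (σ i) / ∑ k, if θ i ≤ θ k then M i (σ k) else 0) ≤ 1 := by
  set τ := Tuple.sort θ with hτ
  have hmono : Monotone (θ ∘ τ) := Tuple.monotone_sort θ
  rw [← sum_perm_prod_div_tail_sum n (fun i j => M (τ i) j) (fun i j => hM _ _),
    ← Equiv.sum_comp (Equiv.mulRight τ⁻¹)]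
  refine Finset.sum_le_sum fun σ _ => ?_
  rw [← Equiv.prod_comp τ]
  refine Finset.prod_le_prod (fun i _ => ?_) (fun i _ => ?_)
  · refine div_nonneg (hM _ _).le (Finset.sum_nonneg fun k _ => ?_)
    split_ifs
    exacts [(hM _ _).le, le_rfl]
  · simp only [Equiv.coe_mulRight, Equiv.Perm.mul_apply, Equiv.Perm.inv_def, Equiv.symm_apply_apply]
    refine div_le_div_of_nonneg_left (hM _ _).le ?_ ?_
    · refine Finset.sum_pos' (fun k _ => ?_) ⟨i, Finset.mem_univ _, by simpa using hM _ _⟩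
      split_ifs
      exacts [(hM _ _).le, le_rfl]
    · rw [← Equiv.sum_comp τ (fun k => if θ (τ i) ≤ θ k then M (τ i) (σ (τ.symm k)) else 0)]
      refine Finset.sum_le_sum fun k _ => ?_
      simp only [Equiv.symm_apply_apply]
      split_ifs with h1 h2 h2
      · rfl
      · exact absurd (hmono h1) h2
      · exact (hM _ _).le
      · rfl

lemma sum_pi_apply {ι : Type*} [Fintype ι] [DecidableEq ι] {β : Type*} [Fintype β] (i : ι)
    (φ : β → ℝ) :
    ∑ θ : ι → β, φ (θ i) = (Fintype.card β : ℝ) ^ (Fintype.card ι - 1) * ∑ b, φ b := by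
  rw [← Equiv.sum_comp (Equiv.funSplitAt i β).symm, Fintype.sum_prod_type]
  simp only [Equiv.funSplitAt_symm_apply, dite_true, Finset.sum_const, Finset.card_univ]
  simp [Finset.mul_sum, Fintype.card_subtype_compl]

lemma sum_pi_apply₂ {ι : Type*} [Fintype ι] [DecidableEq ι] {β : Type*} [Fintype β] {i k : ι}
    (hik : k ≠ i) (φ : β → β → ℝ) :
    ∑ θ : ι → β, φ (θ i) (θ k) =
      (Fintype.card β : ℝ) ^ (Fintype.card ι - 2) * ∑ b, ∑ c, φ b c := by
  rw [← Equiv.sum_comp (Equiv.funSplitAt i β).symm, Fintype.sum_prod_type, Finset.mul_sum]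
  refine Finset.sum_congr rfl fun b _ => ?_
  simp only [Equiv.funSplitAt_symm_apply, dite_true, hik, dite_false]
  rw [sum_pi_apply (⟨k, hik⟩ : {j // j ≠ i}) (φ b)]
  simp [Fintype.card_subtype_compl, Nat.sub_sub]

lemma sum_label_indicator_div {n K : ℕ} (hK : 0 < K) (i k : Fin n) :
    ∑ θ : Fin n → Fin K, (if θ i ≤ θ k then (1 : ℝ) else 0) / (((K : ℝ) - (θ i : ℕ)) / K) ≤
      (K : ℝ) ^ n * (1 + if k = i then (K : ℝ) else 0) := by
  have hK' : (0 : ℝ) < K := by exact_mod_cast hK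
  have hc : ∀ l : Fin K, (1 : ℝ) ≤ (K : ℝ) - (l : ℕ) := fun l => by
    have : (l : ℕ) + 1 ≤ K := l.2
    have : ((l : ℕ) : ℝ) + 1 ≤ K := by exact_mod_cast this
    linarith
  by_cases hik : k = i
  · subst hik
    simp only [le_refl, if_true]
    calc ∑ θ : Fin n → Fin K, (1 : ℝ) / (((K : ℝ) - (θ k : ℕ)) / K)
        ≤ ∑ θ : Fin n → Fin K, (K : ℝ) := by
          refine Finset.sum_le_sum fun θ _ => ?_
          have := hc (θ k)
          rw [one_div, inv_div, div_le_iff₀ (by linarith)]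
          nlinarith
      _ = (K : ℝ) ^ n * K := by simp
      _ ≤ _ := by
          have : (0 : ℝ) < (K : ℝ) ^ n := by positivity
          nlinarith
  · have hn : 2 ≤ n := by
      have h1 := i.2
      have h2 := k.2
      have h3 : (k : ℕ) ≠ i := fun h => hik (Fin.ext h)
      omega
    rw [sum_pi_apply₂ hik (fun b c : Fin K =>
      (if b ≤ c then (1 : ℝ) else 0) / (((K : ℝ) - (b : ℕ)) / K))]
    have h : ∀ b : Fin K, ∑ c : Fin K,
        (if b ≤ c then (1 : ℝ) else 0) / (((K : ℝ) - (b : ℕ)) / K) = K := by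
      intro b
      rw [← Finset.sum_div, Finset.sum_ite]
      have h1 := hc b
      have : (Finset.univ.filter (fun c : Fin K => b ≤ c)).card = K - b := by
        rw [← Fin.card_Ici b]
        congr 1
        ext; simp
      simp [this, Nat.cast_sub b.2.le]
      field_simp
    simp only [h, hik, if_false, Finset.sum_const, Finset.card_univ, Fintype.card_fin]
    obtain ⟨m, rfl⟩ := Nat.exists_eq_add_of_le hn
    simp
    ring_nf
    rfl

/-- An entropy upper bound for the permanent of a positive matrix, obtained by processing the rows in
the order of independent uniform labels in `Fin K`. -/
lemma permanent_le_exp (n K : ℕ) (hn : 0 < n) (hK : 0 < K) (M : Matrix (Fin n) (Fin n) ℝ)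
    (hM : ∀ i j, 0 < M i j) (lam : ℝ) (hle : ∀ i j, M i j ≤ lam) :
    permanent M ≤ Real.exp (n * ((K : ℝ)⁻¹ * ∑ l : Fin K, Real.log (((K : ℝ) - (l : ℕ)) / K)
      + Real.log ((∑ i, ∑ j, M i j) / n + lam * K))) := by
  have hK' : (0 : ℝ) < K := by exact_mod_cast hK
  have hn' : (0 : ℝ) < n := by exact_mod_cast hn
  have hN : (0 : ℝ) < (K : ℝ) ^ n := by positivity
  set c : Fin K → ℝ := fun l => ((K : ℝ) - (l : ℕ)) / K with hc_def
  have hc : ∀ l, 0 < c l := fun l => by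
    have : ((l : ℕ) : ℝ) < K := by exact_mod_cast l.2
    exact div_pos (by linarith) hK'
  set Y : (Fin n → Fin K) → Equiv.Perm (Fin n) → Fin n → ℝ := fun θ σ i =>
    ∑ k, if θ i ≤ θ k then M i (σ k) else 0 with hY_def
  have hY : ∀ θ σ i, 0 < Y θ σ i := fun θ σ i => by
    refine Finset.sum_pos' (fun k _ => ?_) ⟨i, Finset.mem_univ _, by simpa using hM _ _⟩
    split_ifs
    exacts [(hM _ _).le, le_rfl]
  set q : (Fin n → Fin K) → Equiv.Perm (Fin n) → ℝ := fun θ σ => ∏ i, (M i (σ i) / Y θ σ i)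
    with hq_def
  have hq : ∀ θ σ, 0 < q θ σ := fun θ σ => Finset.prod_pos fun i _ => div_pos (hM _ _) (hY _ _ _)
  have hcard : (Finset.univ : Finset (Fin n → Fin K)).card = K ^ n := by simp
  set L := (K : ℝ)⁻¹ * ∑ l : Fin K, Real.log (c l) with hL
  set B := (∑ i, ∑ j, M i j) / n + lam * K with hB
  have hlogw : ∀ σ : Equiv.Perm (Fin n), ∀ θ : Fin n → Fin K, Real.log (∏ i, M i (σ i)) =
      Real.log (q θ σ) + ∑ i, Real.log (c (θ i)) + ∑ i, Real.log (Y θ σ i / c (θ i)) := by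
    intro σ θ
    rw [hq_def, Real.log_prod (fun i _ => (hM _ _).ne'),
      Real.log_prod (fun i _ => (div_pos (hM _ _) (hY _ _ _)).ne'),
      ← Finset.sum_add_distrib, ← Finset.sum_add_distrib]
    refine Finset.sum_congr rfl fun i _ => ?_
    rw [Real.log_div (hM _ _).ne' (hY _ _ _).ne', Real.log_div (hY _ _ _).ne' (hc _).ne']
    ring
  have hcsum : ∑ θ : Fin n → Fin K, ((K : ℝ) ^ n)⁻¹ * ∑ i, Real.log (c (θ i)) = n * L := by
    rw [← Finset.mul_sum, Finset.sum_comm]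
    simp_rw [sum_pi_apply _ (fun l => Real.log (c l))]
    obtain ⟨m, rfl⟩ : ∃ m, n = m + 1 := ⟨n - 1, by omega⟩
    simp [hL]
    field_simp
    ring
  have hYsum : ∀ σ : Equiv.Perm (Fin n),
      ∑ θ : Fin n → Fin K, ((K : ℝ) ^ n)⁻¹ * ∑ i, Real.log (Y θ σ i / c (θ i)) ≤
        n * Real.log B := by
    intro σ
    have hjen := (strictConcaveOn_log_Ioi.concaveOn).le_map_sum
      (t := (Finset.univ : Finset ((Fin n → Fin K) × Fin n)))
      (w := fun _ => ((K : ℝ) ^ n * n)⁻¹) (p := fun x => Y x.1 σ x.2 / c (x.1 x.2))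
      (fun _ _ => by positivity) (by simp; field_simp)
      (fun x _ => div_pos (hY _ _ _) (hc _))
    simp only [smul_eq_mul, ← Finset.mul_sum, Fintype.sum_prod_type] at hjen
    have hZ : ((K : ℝ) ^ n * n)⁻¹ * ∑ θ : Fin n → Fin K, ∑ i, Y θ σ i / c (θ i) ≤ B := by
      rw [Finset.sum_comm]
      have h1 : ∀ i, ∑ θ : Fin n → Fin K, Y θ σ i / c (θ i) ≤
          (K : ℝ) ^ n * (∑ j, M i j + lam * K) := by
        intro i
        calc ∑ θ : Fin n → Fin K, Y θ σ i / c (θ i)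
            = ∑ k, M i (σ k) * ∑ θ : Fin n → Fin K,
              (if θ i ≤ θ k then (1 : ℝ) else 0) / (((K : ℝ) - (θ i : ℕ)) / K) := by
              simp only [hY_def, Finset.sum_div, Finset.mul_sum]
              rw [Finset.sum_comm]
              refine Finset.sum_congr rfl fun k _ => Finset.sum_congr rfl fun θ _ => ?_
              split_ifs <;> simp [hc_def, div_eq_mul_inv]
          _ ≤ ∑ k, M i (σ k) * ((K : ℝ) ^ n * (1 + if k = i then (K : ℝ) else 0)) :=
              Finset.sum_le_sum fun k _ =>
                mul_le_mul_of_nonneg_left (sum_label_indicator_div hK i k) (hM _ _).le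
          _ = (K : ℝ) ^ n * (∑ k, M i (σ k) + M i (σ i) * K) := by
              simp only [mul_add, Finset.sum_add_distrib, mul_ite, mul_zero, mul_one,
                Finset.sum_ite_eq', Finset.mem_univ, if_true, Finset.mul_sum]
              congr 1
              · exact Finset.sum_congr rfl fun _ _ => mul_comm _ _
              · ring
          _ ≤ _ := by
              rw [Equiv.sum_comp σ (fun k => M i k)]
              gcongr
              exact hle _ _
      calc ((K : ℝ) ^ n * n)⁻¹ * ∑ i, ∑ θ : Fin n → Fin K, Y θ σ i / c (θ i)
          ≤ ((K : ℝ) ^ n * n)⁻¹ * ∑ i, (K : ℝ) ^ n * (∑ j, M i j + lam * K) := by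
            gcongr with i
            exact h1 i
        _ = B := by
            rw [← Finset.mul_sum, Finset.sum_add_distrib, hB]
            simp
            field_simp
    have hZpos : 0 < ((K : ℝ) ^ n * n)⁻¹ * ∑ θ : Fin n → Fin K, ∑ i, Y θ σ i / c (θ i) := by
      have : Nonempty (Fin n) := ⟨⟨0, hn⟩⟩
      have : Nonempty (Fin K) := ⟨⟨0, hK⟩⟩
      refine mul_pos (by positivity) (Finset.sum_pos (fun θ _ => Finset.sum_pos (fun i _ =>
        div_pos (hY _ _ _) (hc _)) Finset.univ_nonempty) Finset.univ_nonempty)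
    have h2 := hjen.trans (Real.log_le_log hZpos hZ)
    rw [← Finset.mul_sum]
    rw [mul_inv, mul_comm (((K : ℝ) ^ n)⁻¹), mul_assoc, inv_mul_le_iff₀ hn'] at h2
    exact h2
  have hw : ∀ σ : Equiv.Perm (Fin n), ∏ i, M i (σ i) ≤
      (∑ θ, ((K : ℝ) ^ n)⁻¹ * q θ σ) * Real.exp (n * (L + Real.log B)) := by
    intro σ
    have hwpos : 0 < ∏ i, M i (σ i) := Finset.prod_pos fun i _ => hM _ _
    have h1 : Real.log (∏ i, M i (σ i)) = ∑ θ : Fin n → Fin K, ((K : ℝ) ^ n)⁻¹ *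
        Real.log (q θ σ) + n * L +
        ∑ θ : Fin n → Fin K, ((K : ℝ) ^ n)⁻¹ * ∑ i, Real.log (Y θ σ i / c (θ i)) := by
      rw [← hcsum, ← Finset.sum_add_distrib, ← Finset.sum_add_distrib]
      simp_rw [← mul_add, ← hlogw]
      simp
      field_simp
    have h2 := convexOn_exp.map_sum_le (t := (Finset.univ : Finset (Fin n → Fin K)))
      (w := fun _ => ((K : ℝ) ^ n)⁻¹) (p := fun θ => Real.log (q θ σ))
      (fun _ _ => by positivity) (by simp; field_simp) (fun _ _ => Set.mem_univ _)
    simp only [smul_eq_mul, Real.exp_log (hq _ _)] at h2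
    rw [← Real.exp_log hwpos, h1, add_assoc, Real.exp_add]
    refine mul_le_mul h2 (Real.exp_le_exp.2 ?_) (Real.exp_pos _).le ?_
    · have := hYsum σ
      linarith
    · exact Finset.sum_nonneg fun θ _ => mul_nonneg (by positivity) (hq _ _).le
  calc permanent M ≤ ∑ σ : Equiv.Perm (Fin n),
        (∑ θ, ((K : ℝ) ^ n)⁻¹ * q θ σ) * Real.exp (n * (L + Real.log B)) :=
        Finset.sum_le_sum fun σ _ => hw σ
    _ = (∑ θ, ((K : ℝ) ^ n)⁻¹ * ∑ σ, q θ σ) * Real.exp (n * (L + Real.log B)) := by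
        rw [← Finset.sum_mul, Finset.sum_comm]
        simp_rw [Finset.mul_sum]
    _ ≤ (∑ θ : Fin n → Fin K, ((K : ℝ) ^ n)⁻¹ * 1) * Real.exp (n * (L + Real.log B)) := by
        gcongr with θ
        exact sum_perm_prod_div_label_sum_le n K M hM θ
    _ = _ := by
        simp
        field_simp

/-- The permanent of the matrix whose first `k` columns are equal to `z` and whose other columns
are those of `a`. -/
def mixedPerm {R : Type*} [CommSemiring R] {n : ℕ} (a : Fin n → Fin n → R) (k : ℕ)
    (z : Fin n → R) : R :=
  ∑ π : Equiv.Perm (Fin n), ∏ j : Fin n, if (j : ℕ) < k then z (π j) else a (π j) j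

lemma map_mixedPerm {R R' : Type*} [CommSemiring R] [CommSemiring R'] (φ : R →+* R') {n : ℕ}
    (a : Fin n → Fin n → R) (k : ℕ) (z : Fin n → R) :
    φ (mixedPerm a k z) = mixedPerm (fun i j => φ (a i j)) k (fun i => φ (z i)) := by
  simp only [mixedPerm, map_sum, map_prod, apply_ite φ]

lemma mixedPerm_mul {R : Type*} [CommSemiring R] {n k : ℕ} (hk : k ≤ n)
    (a : Fin n → Fin n → R) (c : R) (z : Fin n → R) :
    mixedPerm a k (fun i => c * z i) = c ^ k * mixedPerm a k z := by
  have hcard : (Finset.univ.filter (fun j : Fin n => (j : ℕ) < k)).card = k := by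
    rw [Fin.card_filter_val_lt, min_eq_right hk]
  have : c ^ k = ∏ j : Fin n, if (j : ℕ) < k then c else 1 := by
    rw [Finset.prod_ite]
    simp [hcard]
  simp only [mixedPerm, Finset.mul_sum, this, ← Finset.prod_mul_distrib]
  refine Finset.sum_congr rfl fun π _ => Finset.prod_congr rfl fun j _ => ?_
  split_ifs <;> simp

lemma mixedPerm_self {R : Type*} [CommSemiring R] {n : ℕ} (a : Fin n → Fin n → R)
    (z : Fin n → R) : mixedPerm a n z = n.factorial * ∏ i, z i := by
  simp only [mixedPerm, Fin.is_lt, if_true]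
  simp_rw [Equiv.prod_comp _ z]
  simp [Fintype.card_perm]

lemma mixedPerm_pos {n : ℕ} {a : Fin n → Fin n → ℝ} (ha : ∀ i j, 0 < a i j) (k : ℕ)
    {z : Fin n → ℝ} (hz : ∀ i, 0 < z i) : 0 < mixedPerm a k z := by
  refine Finset.sum_pos (fun π _ => Finset.prod_pos fun j _ => ?_) Finset.univ_nonempty
  split_ifs
  exacts [hz _, ha _ _]

open Polynomial in
lemma derivative_mixedPerm_line {R : Type*} [CommRing R] {n : ℕ} (k : Fin n)
    (a : Fin n → Fin n → R) (z : Fin n → R) :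
    derivative (mixedPerm (fun i j => C (a i j)) (k + 1) (fun i => C (z i) + X * C (a i k))) =
      ((k : ℕ) + 1 : R[X]) *
        mixedPerm (fun i j => C (a i j)) k (fun i => C (z i) + X * C (a i k)) := by
  set w : Fin n → R[X] := fun i => C (z i) + X * C (a i k) with hw
  have hcard : (Finset.univ.filter (fun j : Fin n => (j : ℕ) < k + 1)).card = k + 1 := by
    rw [Fin.card_filter_val_lt, min_eq_right k.2]
  have hswap : ∀ l : Fin n, (l : ℕ) < k + 1 →
      ∑ π : Equiv.Perm (Fin n), (∏ j ∈ Finset.univ.erase l,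
        if (j : ℕ) < k + 1 then w (π j) else C (a (π j) j)) * C (a (π l) k) =
      mixedPerm (fun i j => C (a i j)) k w := by
    intro l hl
    rw [← Equiv.sum_comp (Equiv.mulRight (Equiv.swap l k)), mixedPerm]
    refine Finset.sum_congr rfl fun π _ => ?_
    rw [← Finset.prod_erase_mul _ _ (Finset.mem_univ k)]
    simp only [Equiv.coe_mulRight, Equiv.Perm.mul_apply, Equiv.swap_apply_left, lt_irrefl,
      if_false]
    congr 1
    refine Finset.prod_bij' (fun j _ => Equiv.swap l k j) (fun j _ => Equiv.swap l k j)
      ?_ ?_ ?_ ?_ ?_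
    · intro j hj
      have : j ≠ l := by simpa using hj
      simp [Equiv.swap_apply_eq_iff, this]
    · intro j hj
      have : j ≠ k := by simpa using hj
      simp [Equiv.swap_apply_eq_iff, this]
    · intro j _
      simp
    · intro j _
      simp
    · intro j hj
      have hjl : j ≠ l := by simpa using hj
      by_cases hjk : j = k
      · subst hjk
        have : (l : ℕ) < j := by
          have : (l : ℕ) ≠ j := fun h => hjl (Fin.ext h.symm)
          omega
        simp [this]
      · rw [Equiv.swap_apply_of_ne_of_ne hjl hjk]
        have : (j : ℕ) ≠ k := fun h => hjk (Fin.ext h)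
        have h2 : (j : ℕ) < k + 1 ↔ (j : ℕ) < k := by omega
        simp only [h2]
  have hder : ∀ i, derivative (w i) = C (a i k) := by
    intro i
    simp [hw]
  rw [mixedPerm, derivative_sum]
  simp_rw [derivative_prod_finset]
  rw [Finset.sum_comm]
  have : ∀ l : Fin n, ∑ π : Equiv.Perm (Fin n), (∏ j ∈ Finset.univ.erase l,
        if (j : ℕ) < k + 1 then w (π j) else C (a (π j) j)) *
        derivative (if (l : ℕ) < k + 1 then w (π l) else C (a (π l) l)) =
      if (l : ℕ) < k + 1 then mixedPerm (fun i j => C (a i j)) k w else 0 := by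
    intro l
    split_ifs with h
    · simp only [hder]
      exact hswap l h
    · simp
  simp_rw [this]
  rw [← Finset.sum_filter, Finset.sum_const, hcard]
  simp

lemma Multiset.re_sum_pos {m : Multiset ℂ} (hm : m ≠ 0) (h : ∀ x ∈ m, 0 < x.re) :
    0 < m.sum.re := by
  induction m using Multiset.induction_on with
  | empty => exact absurd rfl hm
  | cons b s ih =>
    have hb := h b (Multiset.mem_cons_self b s)
    rw [Multiset.sum_cons, Complex.add_re]
    by_cases hs : s = 0
    · simpa [hs] using hb
    · exact add_pos hb (ih hs fun x hx => h x (Multiset.mem_cons_of_mem hx))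

open Polynomial in
lemma eval_mixedPerm_line {R : Type*} [CommRing R] {n : ℕ} (k : ℕ)
    (a : Fin n → Fin n → R) (z v : Fin n → R) (s : R) :
    (mixedPerm (fun i j => C (a i j)) k (fun i => C (z i) + X * C (v i))).eval s =
      mixedPerm a k (fun i => z i + s * v i) := by
  rw [← coe_evalRingHom, map_mixedPerm]
  simp only [coe_evalRingHom, eval_C, eval_add, eval_mul, eval_X]

open Polynomial in
lemma mixedPerm_ne_zero {n : ℕ} (a : Fin n → Fin n → ℝ) (ha : ∀ i j, 0 < a i j) (k : ℕ)
    (hk : k ≤ n) : ∀ z : Fin n → ℂ, (∀ i, 0 < (z i).re) →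
      mixedPerm (fun i j => (a i j : ℂ)) k z ≠ 0 := by
  induction hk using Nat.decreasingInduction with
  | self =>
    intro z hz
    rw [mixedPerm_self]
    refine mul_ne_zero (by exact_mod_cast n.factorial_ne_zero)
      (Finset.prod_ne_zero_iff.2 fun i _ h => ?_)
    have := hz i
    rw [h] at this
    simp at this
  | of_succ k hk ih =>
    intro z hz h0
    set b : Fin n → Fin n → ℂ := fun i j => (a i j : ℂ) with hb
    set kk : Fin n := ⟨k, hk⟩ with hkk
    set Q : ℂ[X] := mixedPerm (fun i j => C (b i j)) (k + 1)
      (fun i => C (z i) + X * C (b i kk)) with hQ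
    have hQeval : ∀ s, Q.eval s = mixedPerm b (k + 1) (fun i => z i + s * b i kk) := fun s =>
      eval_mixedPerm_line _ _ _ _ _
    have hQne : ∀ s : ℂ, 0 ≤ s.re → Q.eval s ≠ 0 := by
      intro s hs
      rw [hQeval]
      refine ih _ fun i => ?_
      have h1 := hz i
      have h2 := mul_nonneg hs (ha i kk).le
      simp [hb]
      linarith
    have hQ' : (derivative Q).eval 0 = 0 := by
      rw [hQ, derivative_mixedPerm_line kk b z, eval_mul, eval_mixedPerm_line]
      simp [h0, hkk]
    have hsplit : Q.Splits := IsAlgClosed.splits Q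
    have hQ0 : Q ≠ 0 := fun h => hQne 0 le_rfl (by simp [h])
    have hsum := hsplit.eval_derivative_div_eval_of_ne_zero (hQne 0 le_rfl)
    rw [hQ', zero_div] at hsum
    have hroots : Q.roots = 0 := by
      by_contra hne
      have hpos : 0 < ((Q.roots.map fun r => 1 / (0 - r)).sum).re := by
        refine Multiset.re_sum_pos (by simpa using hne) fun x hx => ?_
        obtain ⟨r, hr, rfl⟩ := Multiset.mem_map.1 hx
        have hr0 : Q.eval r = 0 := (mem_roots hQ0).1 hr
        have hre : r.re < 0 := by
          by_contra hcon
          exact hQne r (not_lt.1 hcon) hr0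
        have hrne : r ≠ 0 := fun h => by simp [h] at hre
        simp only [zero_sub, one_div, Complex.inv_re, Complex.neg_re, Complex.normSq_neg]
        exact div_pos (by linarith) (Complex.normSq_pos.2 hrne)
      rw [← hsum] at hpos
      simp at hpos
    have hdeg : Q.natDegree = 0 := by
      rw [hsplit.natDegree_eq_card_roots, hroots]
      simp
    obtain ⟨q, hq⟩ := natDegree_eq_zero.1 hdeg
    set P : ℂ[X] := mixedPerm (fun i j => C (b i j)) (k + 1)
      (fun i => C (b i kk) + X * C (z i)) with hP
    have hPeval : ∀ s, P.eval s = mixedPerm b (k + 1) (fun i => b i kk + s * z i) := fun s =>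
      eval_mixedPerm_line _ _ _ _ _
    have hPQ : X * P = X * (C q * X ^ (k + 1)) := by
      refine Polynomial.funext fun s => ?_
      by_cases hs : s = 0
      · simp [hs]
      · have : P.eval s = s ^ (k + 1) * Q.eval s⁻¹ := by
          rw [hPeval, hQeval, ← mixedPerm_mul hk]
          congr 1
          ext i
          field_simp
          ring
        simp only [eval_mul, eval_X, eval_C, eval_pow, this, ← hq]
        ring
    have hPQ' := mul_left_cancel₀ X_ne_zero hPQ
    have h1 : P.eval 0 = 0 := by simp [hPQ']
    rw [hPeval] at h1
    refine ih _ (fun i => ?_) h1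
    simpa [hb] using ha i kk

open Polynomial in
lemma norm_eval_le_of_roots_neg {Q : ℂ[X]} (h0 : Q.eval 0 ≠ 0)
    (hr : ∀ r : ℂ, Q.eval r = 0 → r.im = 0 ∧ r.re < 0) {t : ℝ} (ht : 0 ≤ t) :
    ‖Q.eval (t : ℂ)‖ ≤
      ‖Q.eval 0‖ * Real.exp (t * ((derivative Q).eval 0 / Q.eval 0).re) := by
  have hsplit : Q.Splits := IsAlgClosed.splits Q
  have hQ0 : Q ≠ 0 := fun h => h0 (by simp [h])
  rw [hsplit.eval_derivative_div_eval_of_ne_zero h0, hsplit.eval_eq_prod_roots,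
    hsplit.eval_eq_prod_roots 0, norm_mul, norm_mul, mul_assoc]
  refine mul_le_mul_of_nonneg_left ?_ (norm_nonneg _)
  have hroots : ∀ r ∈ Q.roots, r.im = 0 ∧ r.re < 0 := fun r h => hr r ((mem_roots hQ0).1 h)
  generalize Q.roots = m at hroots
  induction m using Multiset.induction_on with
  | empty => simp
  | cons r s ih =>
    obtain ⟨h1, h2⟩ := hroots r (Multiset.mem_cons_self r s)
    have ih' := ih fun x hx => hroots x (Multiset.mem_cons_of_mem hx)
    obtain ⟨x, rfl⟩ : ∃ x : ℝ, r = x := ⟨r.re, by apply Complex.ext <;> simp [h1]⟩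
    simp only [Complex.ofReal_re] at h2
    simp only [Multiset.map_cons, Multiset.prod_cons, Multiset.sum_cons, norm_mul,
      Complex.add_re, mul_add, Real.exp_add]
    have hx : ‖(t : ℂ) - x‖ ≤ ‖(0 : ℂ) - x‖ * Real.exp (t * (1 / ((0 : ℂ) - x)).re) := by
      have e1 : (t : ℂ) - x = ((t - x : ℝ) : ℂ) := by push_cast; ring
      have e2 : (0 : ℂ) - x = ((-x : ℝ) : ℂ) := by push_cast; ring
      have e3 : (1 / ((-x : ℝ) : ℂ)).re = 1 / (-x) := by
        rw [← Complex.ofReal_one, ← Complex.ofReal_div, Complex.ofReal_re]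
      rw [e1, e2, e3, Complex.norm_real, Complex.norm_real, Real.norm_of_nonneg (by linarith),
        Real.norm_of_nonneg (by linarith)]
      have := Real.add_one_le_exp (t * (1 / (-x)))
      calc t - x = (-x) * (t * (1 / (-x)) + 1) := by
            have : x ≠ 0 := h2.ne
            field_simp
            ring
        _ ≤ _ := mul_le_mul_of_nonneg_left this (by linarith)
    calc _ ≤ (‖(0 : ℂ) - x‖ * Real.exp (t * (1 / ((0 : ℂ) - x)).re)) * _ :=
          mul_le_mul hx ih' (norm_nonneg _) (by positivity)
      _ = _ := by ring

open Polynomial in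
lemma mixedPerm_line_le {n : ℕ} (a : Fin n → Fin n → ℝ) (ha : ∀ i j, 0 < a i j) (k : Fin n)
    (y : Fin n → ℝ) (hy : ∀ i, 0 < y i) {t : ℝ} (ht : 0 ≤ t) :
    mixedPerm a (k + 1) (fun i => y i + t * a i k) ≤ mixedPerm a (k + 1) y *
      Real.exp (t * (((k : ℕ) + 1) * mixedPerm a k y / mixedPerm a (k + 1) y)) := by
  set b : Fin n → Fin n → ℂ := fun i j => (a i j : ℂ) with hb
  set z : Fin n → ℂ := fun i => (y i : ℂ) with hz
  set Q : ℂ[X] := mixedPerm (fun i j => C (b i j)) (k + 1)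
    (fun i => C (z i) + X * C (b i k)) with hQ
  have hQeval : ∀ s, Q.eval s = mixedPerm b (k + 1) (fun i => z i + s * b i k) := fun s =>
    eval_mixedPerm_line _ _ _ _ _
  have hcast : ∀ (m : ℕ) (w : Fin n → ℝ),
      mixedPerm b m (fun i => (w i : ℂ)) = ((mixedPerm a m w : ℝ) : ℂ) := fun m w =>
    (map_mixedPerm Complex.ofRealHom a m w).symm
  have hQ0 : Q.eval 0 = ((mixedPerm a (k + 1) y : ℝ) : ℂ) := by
    rw [hQeval, ← hcast]
    simp [hz]
  have hQt : Q.eval (t : ℂ) =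
      ((mixedPerm a (k + 1) (fun i => y i + t * a i k) : ℝ) : ℂ) := by
    rw [hQeval, ← hcast]
    simp [hz, hb]
  have hQ' : (derivative Q).eval 0 = ((((k : ℕ) + 1) * mixedPerm a k y : ℝ) : ℂ) := by
    rw [hQ, derivative_mixedPerm_line k b z, eval_mul, eval_mixedPerm_line]
    push_cast
    rw [← hcast]
    simp [hz]
  have hpos := mixedPerm_pos ha (k + 1) hy
  have hne : Q.eval 0 ≠ 0 := by
    rw [hQ0]
    exact_mod_cast hpos.ne'
  have hroots : ∀ r : ℂ, Q.eval r = 0 → r.im = 0 ∧ r.re < 0 := by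
    intro r hr
    by_contra hcon
    have hr0 : r ≠ 0 := fun h => hne (h ▸ hr)
    have hrpos : 0 < ‖r‖ := norm_pos_iff.2 hr0
    have hre : 0 < ‖r‖ + r.re := by
      have h1 := Complex.abs_re_le_norm r
      by_contra hle
      have h2 : r.re = -‖r‖ := by
        have := (abs_le.1 h1).1
        linarith
      refine hcon ⟨?_, by linarith⟩
      have h3 := Complex.sq_norm_sub_sq_re r
      rw [h2] at h3
      have : r.im ^ 2 = 0 := by rw [← h3]; ring
      exact pow_eq_zero_iff (two_ne_zero) |>.1 this
    set c : ℂ := (‖r‖ : ℂ) + (starRingEnd ℂ) r with hc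
    have hcr : c * r = (‖r‖ : ℂ) * ((‖r‖ : ℂ) + r) := by
      rw [hc, add_mul, Complex.conj_mul']
      ring
    have h0 := mixedPerm_mul k.2 b c (fun i => z i + r * b i k)
    rw [← hQeval, hr, mul_zero] at h0
    refine mixedPerm_ne_zero a ha (k + 1) k.2 _ (fun i => ?_) h0
    have e : c * (z i + r * b i k) = c * (y i : ℂ) + (c * r) * (a i k : ℂ) := by
      simp only [hz, hb]; ring
    rw [e, hcr]
    have e1 : (c * (y i : ℂ)).re = (‖r‖ + r.re) * y i := by
      simp [hc]
    have e2 : ((‖r‖ : ℂ) * ((‖r‖ : ℂ) + r) * (a i k : ℂ)).re =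
        ‖r‖ * (‖r‖ + r.re) * a i k := by
      simp
    rw [Complex.add_re, e1, e2]
    have := hy i
    have := ha i k
    positivity
  have key := norm_eval_le_of_roots_neg hne hroots ht
  rw [hQ', hQt, hQ0, ← Complex.ofReal_div, Complex.ofReal_re, Complex.norm_real,
    Complex.norm_real, Real.norm_of_nonneg hpos.le] at key
  exact (le_abs_self _).trans key

lemma mixedPerm_capacity {n : ℕ} (a : Fin n → Fin n → ℝ) (ha : ∀ i j, 0 < a i j)
    (hrow : ∀ i, ∑ j, a i j = 1) (hcol : ∀ j, ∑ i, a i j = 1) (k : ℕ) (hk : k ≤ n)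
    (hk1 : 1 ≤ k) : ∀ x : Fin n → ℝ, (∀ j, 0 < x j) →
      k.factorial * Real.exp (-((n : ℝ) - k)) * ∏ j : Fin n, (if (j : ℕ) < k then x j else 1) ≤
        mixedPerm a k (fun i => ∑ j : Fin n, if (j : ℕ) < k then x j * a i j else 0) := by
  induction hk using Nat.decreasingInduction with
  | self =>
    intro x hx
    rw [mixedPerm_self]
    simp only [sub_self, neg_zero, Real.exp_zero, mul_one, Fin.is_lt, if_true]
    refine mul_le_mul_of_nonneg_left ?_ (by positivity)
    calc ∏ j, x j = ∏ j, ∏ i, x j ^ a i j := by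
          refine Finset.prod_congr rfl fun j _ => ?_
          rw [← Real.rpow_sum_of_pos (hx j), hcol, Real.rpow_one]
      _ = ∏ i, ∏ j, x j ^ a i j := Finset.prod_comm
      _ ≤ ∏ i, ∑ j, x j * a i j := by
          refine Finset.prod_le_prod (fun i _ => Finset.prod_nonneg fun j _ =>
            Real.rpow_nonneg (hx j).le _) fun i _ => ?_
          refine (Real.geom_mean_le_arith_mean_weighted _ _ _ (fun j _ => (ha i j).le) (hrow i)
            (fun j _ => (hx j).le)).trans_eq ?_
          exact Finset.sum_congr rfl fun j _ => mul_comm _ _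
  | of_succ k hk ih =>
    intro x hx
    have hn : 0 < n := by omega
    set kk : Fin n := ⟨k, hk⟩ with hkk
    set y : Fin n → ℝ := fun i => ∑ j : Fin n, if (j : ℕ) < k then x j * a i j else 0 with hy
    have hypos : ∀ i, 0 < y i := fun i => by
      refine Finset.sum_pos' (fun j _ => ?_) ⟨⟨0, hn⟩, Finset.mem_univ _, ?_⟩
      · split_ifs
        exacts [(mul_pos (hx _) (ha _ _)).le, le_rfl]
      · rw [if_pos (show ((⟨0, hn⟩ : Fin n) : ℕ) < k from hk1)]
        exact mul_pos (hx _) (ha _ _)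
    have hR := mixedPerm_pos ha (k + 1) hypos
    have hH := mixedPerm_pos ha k hypos
    set t : ℝ := mixedPerm a (k + 1) y / ((k + 1) * mixedPerm a k y) with ht
    have htpos : 0 < t := by positivity
    have h1 := mixedPerm_line_le a ha kk y hypos htpos.le
    have hexp : t * (((kk : ℕ) + 1) * mixedPerm a kk y / mixedPerm a (kk + 1) y) = 1 := by
      simp only [hkk, ht]
      field_simp
    rw [hexp] at h1
    have h2 := ih (by omega) (fun j => if j = kk then t else x j) (fun j => by
      split_ifs
      exacts [htpos, hx j])
    have hline : (fun i => ∑ j : Fin n,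
        if (j : ℕ) < k + 1 then (if j = kk then t else x j) * a i j else 0) =
        fun i => y i + t * a i kk := by
      ext i
      have : t * a i kk = ∑ j : Fin n, if j = kk then t * a i j else 0 := by simp
      rw [this, hy, ← Finset.sum_add_distrib]
      refine Finset.sum_congr rfl fun j _ => ?_
      by_cases hj : j = kk
      · simp [hj, hkk]
      · have h3 : (j : ℕ) ≠ k := fun h => hj (Fin.ext h)
        have h4 : (j : ℕ) < k + 1 ↔ (j : ℕ) < k := by omega
        simp [hj, h4]
    have hprod : ∏ j : Fin n, (if (j : ℕ) < k + 1 then (if j = kk then t else x j) else 1) =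
        (∏ j : Fin n, if (j : ℕ) < k then x j else 1) * t := by
      have : t = ∏ j : Fin n, if j = kk then t else 1 := by simp
      conv_rhs => rw [this]
      rw [← Finset.prod_mul_distrib]
      refine Finset.prod_congr rfl fun j _ => ?_
      by_cases hj : j = kk
      · simp [hj, hkk]
      · have h3 : (j : ℕ) ≠ k := fun h => hj (Fin.ext h)
        have h4 : (j : ℕ) < k + 1 ↔ (j : ℕ) < k := by omega
        simp [hj, h4]
    rw [hline, hprod] at h2
    have h3 := h2.trans h1
    set Θ := ∏ j : Fin n, if (j : ℕ) < k then x j else 1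
    have hE : Real.exp (-((n : ℝ) - k)) * Real.exp 1 = Real.exp (-((n : ℝ) - (k + 1 : ℕ))) := by
      rw [← Real.exp_add]
      congr 1
      push_cast
      ring
    rw [← hE, Nat.factorial_succ] at h3
    have h4 : (k.factorial * Real.exp (-((n : ℝ) - k)) * Θ) *
        (mixedPerm a (k + 1) y * Real.exp 1) ≤
        mixedPerm a k y * (mixedPerm a (k + 1) y * Real.exp 1) := by
      have := mul_le_mul_of_nonneg_left h3 hH.le
      refine le_trans (le_of_eq ?_) this
      rw [ht]
      push_cast
      field_simp
    exact le_of_mul_le_mul_right h4 (by positivity)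

/-- The asymptotic van der Waerden bound for positive doubly stochastic matrices. -/
lemma exp_neg_le_permanent {n : ℕ} (a : Matrix (Fin n) (Fin n) ℝ) (ha : ∀ i j, 0 < a i j)
    (hrow : ∀ i, ∑ j, a i j = 1) (hcol : ∀ j, ∑ i, a i j = 1) :
    Real.exp (-(n : ℝ)) ≤ permanent a := by
  have hperm : permanent a = mixedPerm (fun i j => a j i) 0 0 := by simp [permanent, mixedPerm]
  rcases Nat.eq_zero_or_pos n with rfl | hn
  · simp [permanent]
  set kk : Fin n := ⟨0, hn⟩
  have h := mixedPerm_capacity (fun i j => a j i) (fun i j => ha j i) hcol hrow 1 hn le_rfl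
    (fun _ => 1) (fun _ => one_pos)
  have hj : ∀ j : Fin n, (j : ℕ) = 0 ↔ j = kk := fun j => by
    rw [Fin.ext_iff]
  rw [hperm]
  calc Real.exp (-(n : ℝ)) ≤ Real.exp (-((n : ℝ) - 1)) := Real.exp_le_exp.2 (by linarith)
    _ ≤ _ := by simpa using h
    _ = _ := by
      refine Finset.sum_congr rfl fun π _ => Finset.prod_congr rfl fun j _ => ?_
      by_cases h : j = kk <;> simp [hj, h]

lemma log_factorial_le {n : ℕ} (hn : 0 < n) :
    Real.log n.factorial ≤ 1 + Real.log n + (n * Real.log n - n) := by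
  induction n, hn using Nat.le_induction with
  | base => simp
  | succ m hm ih =>
    have hm' : (0 : ℝ) < m := by exact_mod_cast hm
    rw [Nat.factorial_succ]
    push_cast
    rw [Real.log_mul (by positivity) (by positivity)]
    have h := Real.log_le_sub_one_of_pos (show (0 : ℝ) < m / (m + 1) by positivity)
    rw [Real.log_div (by positivity) (by positivity)] at h
    have h2 : (m : ℝ) / (m + 1) - 1 = -(1 / (m + 1)) := by field_simp; ring
    rw [h2] at h
    have h3 : (m + 1 : ℝ) * (Real.log m - Real.log (m + 1)) ≤ -1 := by
      calc (m + 1 : ℝ) * (Real.log m - Real.log (m + 1)) ≤ (m + 1) * (-(1 / (m + 1))) := by gcongr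
        _ = -1 := by field_simp
    linarith

lemma le_log_factorial (n : ℕ) : n * Real.log n - n ≤ Real.log n.factorial := by
  rcases Nat.eq_zero_or_pos n with rfl | hn
  · simp
  have hn' : (0 : ℝ) < n := by exact_mod_cast hn
  have h := Real.log_le_log (by positivity) (Real.pow_div_factorial_le_exp (n : ℝ) hn'.le n)
  rw [Real.log_exp, Real.log_div (by positivity) (by positivity), Real.log_pow] at h
  linarith

lemma sum_log_label_le {K : ℕ} (hK : 0 < K) :
    ∑ l : Fin K, Real.log (((K : ℝ) - (l : ℕ)) / K) ≤ 1 + Real.log K - K := by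
  have hK' : (0 : ℝ) < K := by exact_mod_cast hK
  have h1 : ∑ l : Fin K, Real.log (((K : ℝ) - (l : ℕ)) / K) =
      Real.log K.factorial - K * Real.log K := by
    rw [Fin.sum_univ_eq_sum_range (fun l => Real.log (((K : ℝ) - l) / K)),
      ← Finset.sum_range_reflect, ← Finset.prod_range_add_one_eq_factorial]
    push_cast
    rw [Real.log_prod (fun i _ => by positivity)]
    rw [eq_sub_iff_add_eq, ← nsmul_eq_mul]
    conv_lhs => rw [← Finset.card_range K, ← Finset.sum_const, Finset.card_range]
    rw [← Finset.sum_add_distrib]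
    refine Finset.sum_congr rfl fun i hi => ?_
    have hi' : i < K := Finset.mem_range.1 hi
    have e : (K : ℝ) - ((K - 1 - i : ℕ) : ℝ) = i + 1 := by
      rw [Nat.cast_sub (by omega), Nat.cast_sub (by omega)]
      push_cast
      ring
    rw [e, Real.log_div (by positivity) hK'.ne']
    ring
  have := log_factorial_le hK
  linarith

lemma permanent_pos {n : ℕ} {M : Matrix (Fin n) (Fin n) ℝ} (hM : ∀ i j, 0 < M i j) :
    0 < permanent M :=
  Finset.sum_pos (fun _ _ => Finset.prod_pos fun _ _ => hM _ _) Finset.univ_nonempty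

lemma permMean_eq_exp {n : ℕ} {M : Matrix (Fin n) (Fin n) ℝ} (hM : ∀ i j, 0 < M i j) :
    permMean M = Real.exp ((Real.log (permanent M) - Real.log n.factorial) / n) := by
  have := permanent_pos hM
  rw [permMean, Real.rpow_def_of_pos (by positivity), Real.log_div this.ne' (by positivity),
    div_eq_mul_inv]

lemma permMean_le {n K : ℕ} (hn : 0 < n) (hK : 0 < K) (M : Matrix (Fin n) (Fin n) ℝ)
    (hM : ∀ i j, 0 < M i j) (lam : ℝ) (hle : ∀ i j, M i j ≤ lam) :
    permMean M ≤ Real.exp ((1 + Real.log K) / K) *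
      ((∑ i, ∑ j, M i j) / n / n + lam * (K / n)) := by
  have hn' : (0 : ℝ) < n := by exact_mod_cast hn
  have hK' : (0 : ℝ) < K := by exact_mod_cast hK
  have hlam : 0 < lam := (hM ⟨0, hn⟩ ⟨0, hn⟩).trans_le (hle _ _)
  have hs : 0 ≤ ∑ i, ∑ j, M i j :=
    Finset.sum_nonneg fun i _ => Finset.sum_nonneg fun j _ => (hM i j).le
  set B := (∑ i, ∑ j, M i j) / n + lam * K with hB
  have hBpos : 0 < B := by positivity
  have h1 := Real.log_le_log (permanent_pos hM) (permanent_le_exp n K hn hK M hM lam hle)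
  rw [Real.log_exp] at h1
  have h2 := le_log_factorial n
  have h3 : (K : ℝ)⁻¹ * ∑ l : Fin K, Real.log (((K : ℝ) - (l : ℕ)) / K) ≤
      (1 + Real.log K) / K - 1 := by
    calc _ ≤ (K : ℝ)⁻¹ * (1 + Real.log K - K) := by
          gcongr
          exact sum_log_label_le hK
      _ = _ := by field_simp
  have e : (∑ i, ∑ j, M i j) / n / n + lam * (K / n) = B / n := by
    rw [hB]; field_simp
  rw [permMean_eq_exp hM, e, ← Real.exp_log (show 0 < B / n by positivity), ← Real.exp_add,
    Real.exp_le_exp, div_le_iff₀ hn', Real.log_div hBpos.ne' hn'.ne']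
  have h4 := mul_le_mul_of_nonneg_left h3 hn'.le
  rw [← hB] at h1
  nlinarith

lemma abs_patched_row_sub_le {n : ℕ} (M : Matrix (Fin n) (Fin n) ℝ) {lam η : ℝ} (hlam : 1 ≤ lam)
    (hη : 0 ≤ η) (hM : ∀ i j, lam⁻¹ ≤ M i j ∧ M i j ≤ lam) (B C : Finset (Fin n))
    (hC : (C.card : ℝ) ≤ η * n) (hB : ∀ i, i ∉ B → |∑ j, M i j - n| ≤ η * n) (i : Fin n) :
    |∑ j, (if i ∈ B ∨ j ∈ C then 1 else M i j) - n| ≤ (1 + lam) * η * n := by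
  by_cases hi : i ∈ B
  · simp only [hi, true_or, if_true]
    simp
    positivity
  · have e : ∑ j, (if i ∈ B ∨ j ∈ C then 1 else M i j) - n =
        (∑ j, M i j - n) + ∑ j ∈ C, (1 - M i j) := by
      have : ∑ j ∈ C, (1 - M i j) = ∑ j, if j ∈ C then (1 - M i j) else 0 := by
        rw [← Finset.sum_filter]
        simp
      rw [this, sub_add_eq_add_sub, ← Finset.sum_add_distrib]
      congr 1
      refine Finset.sum_congr rfl fun j _ => ?_
      by_cases hj : j ∈ C <;> simp [hi, hj]
    have h1 : |∑ j ∈ C, (1 - M i j)| ≤ lam * (η * n) := by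
      calc |∑ j ∈ C, (1 - M i j)| ≤ ∑ j ∈ C, |1 - M i j| := Finset.abs_sum_le_sum_abs _ _
        _ ≤ ∑ j ∈ C, lam := by
            refine Finset.sum_le_sum fun j _ => abs_le.2 ⟨?_, ?_⟩
            · linarith [(hM i j).2]
            · have : 0 < lam⁻¹ := by positivity
              linarith [(hM i j).1]
        _ = C.card * lam := by simp
        _ ≤ lam * (η * n) := by nlinarith
    rw [e]
    calc _ ≤ |∑ j, M i j - n| + |∑ j ∈ C, (1 - M i j)| := abs_add_le _ _
      _ ≤ η * n + lam * (η * n) := add_le_add (hB i hi) h1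
      _ = _ := by ring

lemma exists_card_le_of_sum_abs_le {n : ℕ} {x : Fin n → ℝ} {η : ℝ} (hη : 0 < η)
    (h : ∑ i, |x i - n| ≤ η ^ 2 * n * n) :
    ∃ B : Finset (Fin n), (B.card : ℝ) ≤ η * n ∧ ∀ i, i ∉ B → |x i - n| ≤ η * n := by
  rcases Nat.eq_zero_or_pos n with rfl | hn
  · exact ⟨∅, by simp, fun i => i.elim0⟩
  have hn' : (0 : ℝ) < n := by exact_mod_cast hn
  refine ⟨Finset.univ.filter fun i => η * n < |x i - n|, ?_, fun i hi => by simpa using hi⟩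
  have h1 : ∑ i ∈ Finset.univ.filter (fun i => η * n < |x i - n|), (η * n) ≤ η ^ 2 * n * n :=
    (Finset.sum_le_sum fun i hi => (Finset.mem_filter.1 hi).2.le).trans
      ((Finset.sum_le_sum_of_subset_of_nonneg (Finset.filter_subset _ _)
        fun i _ _ => abs_nonneg _).trans h)
  rw [Finset.sum_const, nsmul_eq_mul] at h1
  have h2 : 0 < η * n := by positivity
  refine le_of_mul_le_mul_right (h1.trans_eq ?_) h2
  ring

lemma exists_sum_eq_card {n : ℕ} (hn : 0 < n) (M : Matrix (Fin n) (Fin n) ℝ) {ε : ℝ}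
    (hrow : ∀ i, |∑ j, M i j - n| ≤ ε * n) (hcol : ∀ j, |∑ i, M i j - n| ≤ ε * n) :
    ∃ D : Matrix (Fin n) (Fin n) ℝ, (∀ i, ∑ j, D i j = n) ∧ (∀ j, ∑ i, D i j = n) ∧
      ∀ i j, |D i j - M i j| ≤ 3 * ε := by
  have hn' : (0 : ℝ) < n := by exact_mod_cast hn
  set s := ∑ i, ∑ j, M i j with hs
  have hs' : s = ∑ j, ∑ i, M i j := Finset.sum_comm
  have hdiv : ∀ x : ℝ, |x - n| ≤ ε * n → |1 - x / n| ≤ ε := fun x hx => by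
    have : 1 - x / n = -((x - n) / n) := by field_simp; ring
    rw [this, abs_neg, abs_div, abs_of_pos hn', div_le_iff₀ hn']
    exact hx
  have hsn : |s - n * n| ≤ ε * n * n := by
    have : s - n * n = ∑ i, (∑ j, M i j - n) := by simp [hs]
    rw [this]
    refine (Finset.abs_sum_le_sum_abs _ _).trans ((Finset.sum_le_sum fun i _ => hrow i).trans ?_)
    simp only [Finset.sum_const, Finset.card_univ, Fintype.card_fin, nsmul_eq_mul]
    linarith
  have hsn' : |s / n / n - 1| ≤ ε := by
    have : s / n / n - 1 = (s - n * n) / (n * n) := by field_simp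
    rw [this, abs_div, abs_of_pos (mul_pos hn' hn'), div_le_iff₀ (mul_pos hn' hn')]
    linarith
  refine ⟨fun i j => M i j + (1 - (∑ k, M i k) / n) + (s / n / n - (∑ k, M k j) / n),
    fun i => ?_, fun j => ?_, fun i j => ?_⟩
  · simp only [Finset.sum_add_distrib, Finset.sum_sub_distrib, Finset.sum_const, Finset.card_univ,
      Fintype.card_fin, nsmul_eq_mul, ← Finset.sum_div, ← hs']
    field_simp
    ring
  · simp only [Finset.sum_add_distrib, Finset.sum_sub_distrib, Finset.sum_const, Finset.card_univ,
      Fintype.card_fin, nsmul_eq_mul, ← Finset.sum_div, ← hs]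
    field_simp
    ring
  · have h1 := abs_le.1 (hdiv _ (hrow i))
    have h2 := abs_le.1 (hdiv _ (hcol j))
    have h3 := abs_le.1 hsn'
    exact abs_le.2 ⟨by linarith [h1.1, h2.1, h3.1], by linarith [h1.2, h2.2, h3.2]⟩

lemma pow_mul_exp_neg_le_permanent {n : ℕ} (hn : 0 < n) (D : Matrix (Fin n) (Fin n) ℝ)
    (hD : ∀ i j, 0 < D i j) (hrow : ∀ i, ∑ j, D i j = n) (hcol : ∀ j, ∑ i, D i j = n) :
    (n : ℝ) ^ n * Real.exp (-(n : ℝ)) ≤ permanent D := by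
  have hn' : (0 : ℝ) < n := by exact_mod_cast hn
  have h := exp_neg_le_permanent (fun i j => D i j / n) (fun i j => div_pos (hD i j) hn')
    (fun i => by rw [← Finset.sum_div, hrow, div_self hn'.ne'])
    (fun j => by rw [← Finset.sum_div, hcol, div_self hn'.ne'])
  have e : permanent D = (n : ℝ) ^ n * permanent (fun i j => D i j / n) := by
    simp only [permanent, Finset.mul_sum]
    refine Finset.sum_congr rfl fun π _ => ?_
    rw [Finset.prod_div_distrib, Finset.prod_const, Finset.card_univ, Fintype.card_fin]
    field_simp
  rw [e]
  gcongr

lemma prod_mul_prod_mul_permanent_le {n : ℕ} {M D : Matrix (Fin n) (Fin n) ℝ} {f g : Fin n → ℝ}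
    (h0 : ∀ i j, 0 ≤ f i * g j * D i j) (h : ∀ i j, f i * g j * D i j ≤ M i j) :
    (∏ i, f i) * (∏ j, g j) * permanent D ≤ permanent M := by
  rw [permanent, permanent, Finset.mul_sum]
  refine Finset.sum_le_sum fun π _ => ?_
  rw [← Equiv.prod_comp π g, ← Finset.prod_mul_distrib, ← Finset.prod_mul_distrib]
  exact Finset.prod_le_prod (fun i _ => h0 i (π i)) fun i _ => h i (π i)

lemma le_permMean {n : ℕ} (hn : 0 < n) (M : Matrix (Fin n) (Fin n) ℝ) {lam η : ℝ}
    (hlam : 1 ≤ lam) (hη : 0 < η) (hc : 3 * lam * ((1 + lam) * η) < 1)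
    (hM : ∀ i j, lam⁻¹ ≤ M i j ∧ M i j ≤ lam)
    (hrow : ∑ i, |∑ j, M i j - n| ≤ η ^ 2 * n * n)
    (hcol : ∑ j, |∑ i, M i j - n| ≤ η ^ 2 * n * n) :
    Real.exp (-(2 * η * Real.log lam) - Real.log (1 + 3 * lam * ((1 + lam) * η)) -
      (1 + Real.log n) / n) ≤ permMean M := by
  have hn' : (0 : ℝ) < n := by exact_mod_cast hn
  have hl0 : 0 < lam := by linarith
  have hli : lam⁻¹ ≤ 1 := inv_le_one_of_one_le₀ hlam
  have hli0 : 0 < lam⁻¹ := by positivity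
  obtain ⟨B, hBc, hB⟩ := exists_card_le_of_sum_abs_le hη hrow
  obtain ⟨C, hCc, hC⟩ := exists_card_le_of_sum_abs_le hη hcol
  set ε := (1 + lam) * η with hε
  set M' : Matrix (Fin n) (Fin n) ℝ := fun i j => if i ∈ B ∨ j ∈ C then 1 else M i j with hM'
  have hrow' : ∀ i, |∑ j, M' i j - n| ≤ ε * n :=
    abs_patched_row_sub_le M hlam hη.le hM B C hCc hB
  have hcol' : ∀ j, |∑ i, M' i j - n| ≤ ε * n := fun j => by
    have := abs_patched_row_sub_le (fun j i => M i j) hlam hη.le (fun j i => hM i j) C B hBc hC j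
    simpa only [hM', or_comm] using this
  obtain ⟨D, hDr, hDc, hD⟩ := exists_sum_eq_card hn M' hrow' hcol'
  have hM'l : ∀ i j, lam⁻¹ ≤ M' i j := fun i j => by
    simp only [hM']
    split_ifs
    exacts [hli, (hM i j).1]
  have hε0 : 0 < ε := by positivity
  have h3 : 3 * ε < lam⁻¹ := by
    rw [← one_div, lt_div_iff₀ hl0]
    linarith
  have hDpos : ∀ i j, 0 < D i j := fun i j => by
    linarith [(abs_le.1 (hD i j)).1, hM'l i j]
  set c := 3 * lam * ε with hcdef
  have hc0 : 0 < c := by positivity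
  have hDle : ∀ i j, D i j ≤ (1 + c) * M' i j := fun i j => by
    have h4 : 3 * ε ≤ c * M' i j := by
      calc 3 * ε = c * lam⁻¹ := by rw [hcdef]; field_simp
        _ ≤ _ := by gcongr; exact hM'l i j
    linarith [(abs_le.1 (hD i j)).2]
  have hperm := prod_mul_prod_mul_permanent_le (M := M) (D := D)
    (f := fun i => (1 + c)⁻¹ * if i ∈ B then lam⁻¹ else 1)
    (g := fun j => if j ∈ C then lam⁻¹ else 1)
    (fun i j => mul_nonneg (mul_nonneg (mul_nonneg (by positivity) (by split_ifs <;> positivity))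
      (by split_ifs <;> positivity)) (hDpos i j).le)
    (fun i j => by
      have h5 : (1 + c)⁻¹ * D i j ≤ M' i j := by
        rw [inv_mul_le_iff₀ (by positivity)]
        exact hDle i j
      have h6 : (if i ∈ B then lam⁻¹ else 1) * (if j ∈ C then lam⁻¹ else 1) * M' i j ≤ M i j := by
        have := (hM i j).1
        by_cases hi : i ∈ B <;> by_cases hj : j ∈ C <;> simp [hM', hi, hj]
        · nlinarith
        · linarith
        · linarith
      refine le_trans (le_of_eq_of_le ?_ (mul_le_mul_of_nonneg_left h5 ?_)) h6
      · ring
      · split_ifs <;> positivity)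
  rw [Finset.prod_mul_distrib, Finset.prod_const, Finset.prod_ite, Finset.prod_ite,
    Finset.prod_const_one, Finset.prod_const_one, Finset.prod_const, Finset.prod_const,
    Finset.card_univ, Fintype.card_fin, Finset.filter_univ_mem, Finset.filter_univ_mem,
    mul_one, mul_one] at hperm
  have hperm2 := (mul_le_mul_of_nonneg_left (pow_mul_exp_neg_le_permanent hn D hDpos hDr hDc)
    (by positivity)).trans hperm
  have hlog := Real.log_le_log (by positivity) hperm2
  rw [Real.log_mul (by positivity) (by positivity), Real.log_mul (by positivity) (by positivity),
    Real.log_mul (by positivity) (by positivity),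
    Real.log_mul (by positivity) (Real.exp_ne_zero _), Real.log_exp] at hlog
  simp only [Real.log_pow, Real.log_inv] at hlog
  have hLl : 0 ≤ Real.log lam := Real.log_nonneg hlam
  have h7 := log_factorial_le hn
  have hMpos : ∀ i j, 0 < M i j := fun i j => hli0.trans_le (hM i j).1
  rw [permMean_eq_exp hMpos, Real.exp_le_exp, le_div_iff₀ hn']
  have h8 : (-(2 * η * Real.log lam) - Real.log (1 + c) - (1 + Real.log n) / n) * n =
      -(2 * η * n * Real.log lam) - n * Real.log (1 + c) - (1 + Real.log n) := by
    field_simp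
  rw [h8]
  have h9 := mul_le_mul_of_nonneg_right hBc hLl
  have h10 := mul_le_mul_of_nonneg_right hCc hLl
  linarith

/-- A sequence of matrices with uniformly bounded entries that are asymptotically doubly stochastic
on average has permanental means tending to `1`. -/
lemma tendsto_permMean (M : ∀ n : ℕ, Matrix (Fin n) (Fin n) ℝ) {lam : ℝ} (hlam : 1 ≤ lam)
    (hM : ∀ n i j, lam⁻¹ ≤ M n i j ∧ M n i j ≤ lam)
    (hrow : Tendsto (fun n : ℕ => (∑ i, |∑ j, M n i j - n|) / n / n) atTop (nhds 0))
    (hcol : Tendsto (fun n : ℕ => (∑ j, |∑ i, M n i j - n|) / n / n) atTop (nhds 0)) :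
    Tendsto (fun n => permMean (M n)) atTop (nhds 1) := by
  have hl0 : 0 < lam := by linarith
  have hMpos : ∀ n i j, 0 < M n i j := fun n i j => (inv_pos.2 hl0).trans_le (hM n i j).1
  set r : ℕ → ℝ := fun n => (∑ i, |∑ j, M n i j - n|) / n / n with hr
  set c : ℕ → ℝ := fun n => (∑ j, |∑ i, M n i j - n|) / n / n with hc
  have hr0 : ∀ n, 0 ≤ r n := fun n => by simp only [hr]; positivity
  have hc0 : ∀ n, 0 ≤ c n := fun n => by simp only [hc]; positivity
  have hinv : Tendsto (fun n : ℕ => (n : ℝ)⁻¹) atTop (nhds 0) := tendsto_inv_atTop_nhds_zero_nat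
  have hlogdiv : Tendsto (fun n : ℕ => (1 + Real.log n) / n) atTop (nhds 0) := by
    have h1 : Tendsto (fun x : ℝ => Real.log x / x) atTop (nhds 0) :=
      Real.isLittleO_log_id_atTop.tendsto_div_nhds_zero
    have h2 := hinv.add (h1.comp tendsto_natCast_atTop_atTop)
    rw [add_zero] at h2
    refine h2.congr fun n => ?_
    simp only [Function.comp, add_div, one_div]
  set η : ℕ → ℝ := fun n => √(r n + c n + (n : ℝ)⁻¹) with hη
  have hηlim : Tendsto η atTop (nhds 0) := by
    have := (Real.continuous_sqrt.tendsto _).comp ((hrow.add hcol).add hinv)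
    simpa [Function.comp_def] using this
  have hclim : Tendsto (fun n => 3 * lam * ((1 + lam) * η n)) atTop (nhds 0) := by
    simpa using (hηlim.const_mul (1 + lam)).const_mul (3 * lam)
  have hlow : Tendsto (fun n : ℕ => Real.exp (-(2 * η n * Real.log lam) -
      Real.log (1 + 3 * lam * ((1 + lam) * η n)) - (1 + Real.log n) / n)) atTop (nhds 1) := by
    have h1 : Tendsto (fun n => Real.log (1 + 3 * lam * ((1 + lam) * η n))) atTop (nhds 0) := by
      have := (hclim.const_add 1).log (by norm_num)
      simpa using this
    have h2 := (((((hηlim.const_mul 2).mul_const (Real.log lam)).neg).sub h1).sub hlogdiv)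
    have h3 := (Real.continuous_exp.tendsto _).comp h2
    simpa [Function.comp_def] using h3
  set K : ℕ → ℕ := fun n => Nat.sqrt n + 1 with hK
  have hKlim : Tendsto K atTop atTop := by
    refine tendsto_atTop.2 fun b => ?_
    filter_upwards [eventually_ge_atTop (b * b)] with n hn
    exact (Nat.le_sqrt.2 hn).trans (Nat.le_succ _)
  have hKdiv : Tendsto (fun n : ℕ => (K n : ℝ) / n) atTop (nhds 0) := by
    have h1 : Tendsto (fun n : ℕ => (√(n : ℝ))⁻¹ + (n : ℝ)⁻¹) atTop (nhds 0) := by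
      have := (tendsto_inv_atTop_zero.comp
        (Real.tendsto_sqrt_atTop.comp tendsto_natCast_atTop_atTop)).add hinv
      simpa [Function.comp_def] using this
    refine squeeze_zero (fun n => by positivity) (fun n => ?_) h1
    have h2 : (K n : ℝ) ≤ √n + 1 := by
      simp only [hK, Nat.cast_add, Nat.cast_one]
      gcongr
      exact Real.nat_sqrt_le_real_sqrt
    calc (K n : ℝ) / n ≤ (√n + 1) / n := by gcongr
      _ = _ := by rw [add_div, Real.sqrt_div_self', one_div, one_div]
  have hup : Tendsto (fun n : ℕ => Real.exp ((1 + Real.log (K n)) / K n) *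
      (1 + r n + lam * (K n / n))) atTop (nhds 1) := by
    have h1 := (Real.continuous_exp.tendsto _).comp (hlogdiv.comp hKlim)
    have h2 := h1.mul ((hrow.const_add 1).add (hKdiv.const_mul lam))
    simpa [Function.comp_def] using h2
  refine tendsto_of_tendsto_of_tendsto_of_le_of_le' hlow hup ?_ ?_
  · filter_upwards [eventually_gt_atTop 0, hclim.eventually_lt_const one_pos] with n hn hcn
    have hn' : (0 : ℝ) < n := by exact_mod_cast hn
    have hpos : 0 < r n + c n + (n : ℝ)⁻¹ := by
      have := hr0 n
      have := hc0 n
      positivity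
    have hsq : η n ^ 2 = r n + c n + (n : ℝ)⁻¹ := Real.sq_sqrt hpos.le
    have hn1 : 0 < (n : ℝ)⁻¹ := by positivity
    refine le_permMean hn (M n) hlam (Real.sqrt_pos.2 hpos) hcn (hM n) ?_ ?_
    · rw [hsq, ← div_le_iff₀ hn', ← div_le_iff₀ hn']
      change r n ≤ _
      linarith [hc0 n]
    · rw [hsq, ← div_le_iff₀ hn', ← div_le_iff₀ hn']
      change c n ≤ _
      linarith [hr0 n]
  · filter_upwards [eventually_gt_atTop 0] with n hn
    have hn' : (0 : ℝ) < n := by exact_mod_cast hn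
    refine (permMean_le (K := K n) hn (Nat.succ_pos _) (M n) (hMpos n) lam fun i j => (hM n i j).2).trans ?_
    gcongr
    rw [div_le_iff₀ hn', div_le_iff₀ hn']
    have h1 : ∑ i, ∑ j, M n i j = n * n + ∑ i, (∑ j, M n i j - n) := by simp
    have h2 : ∑ i, (∑ j, M n i j - n) ≤ ∑ i, |∑ j, M n i j - n| :=
      Finset.sum_le_sum fun i _ => le_abs_self _
    have h3 : r n * n * n = ∑ i, |∑ j, M n i j - n| := by
      simp only [hr]
      field_simp
    rw [h1, add_mul, add_mul, h3]
    linarith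

section MaximalErgodic

variable {Ω : Type*}

/-- The maximum of `0` and the first `n` Birkhoff sums of `f`. -/
def maxBirkhoffSum (T : Ω → Ω) (f : Ω → ℝ) : ℕ → Ω → ℝ
  | 0, _ => 0
  | n + 1, x => max 0 (f x + maxBirkhoffSum T f n (T x))

lemma maxBirkhoffSum_nonneg (T : Ω → Ω) (f : Ω → ℝ) (n : ℕ) (x : Ω) :
    0 ≤ maxBirkhoffSum T f n x := by
  cases n
  · exact le_rfl
  · exact le_max_left _ _

lemma birkhoffSum_le_maxBirkhoffSum (T : Ω → Ω) (f : Ω → ℝ) (n : ℕ) (x : Ω) :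
    birkhoffSum T f n x ≤ maxBirkhoffSum T f n x := by
  induction n generalizing x with
  | zero => simp [maxBirkhoffSum]
  | succ n ih =>
    rw [birkhoffSum_succ']
    exact le_max_of_le_right (by gcongr; exact ih _)

lemma exists_maxBirkhoffSum_eq (T : Ω → Ω) (f : Ω → ℝ) (n : ℕ) (x : Ω) :
    ∃ k, maxBirkhoffSum T f n x = birkhoffSum T f k x := by
  induction n generalizing x with
  | zero => exact ⟨0, by simp [maxBirkhoffSum]⟩
  | succ n ih =>
    obtain ⟨k, hk⟩ := ih (T x)
    rw [maxBirkhoffSum, hk, ← birkhoffSum_succ']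
    rcases max_choice 0 (birkhoffSum T f (k + 1) x) with h | h
    · exact ⟨0, by simpa using h⟩
    · exact ⟨k + 1, h⟩

lemma maxBirkhoffSum_le_succ (T : Ω → Ω) (f : Ω → ℝ) (n : ℕ) (x : Ω) :
    maxBirkhoffSum T f n x ≤ maxBirkhoffSum T f (n + 1) x := by
  induction n generalizing x with
  | zero => exact le_max_left _ _
  | succ n ih => exact max_le_max le_rfl (by gcongr; exact ih _)

lemma birkhoffSum_sub_const (T : Ω → Ω) (f : Ω → ℝ) (c : ℝ) (n : ℕ) (x : Ω) :
    birkhoffSum T (fun y => f y - c) n x = birkhoffSum T f n x - n * c := by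
  simp [birkhoffSum, Finset.sum_sub_distrib]

variable [MeasurableSpace Ω] {P : Measure Ω} {T : Ω → Ω} {f : Ω → ℝ}

lemma measurable_maxBirkhoffSum (hT : Measurable T) (hf : Measurable f) (n : ℕ) :
    Measurable (maxBirkhoffSum T f n) := by
  induction n with
  | zero => exact measurable_const
  | succ n ih => exact measurable_const.max (hf.add (ih.comp hT))

lemma integrable_maxBirkhoffSum (hT : MeasurePreserving T P P) (hf : Integrable f P) (n : ℕ) :
    Integrable (maxBirkhoffSum T f n) P := by
  induction n with
  | zero => exact integrable_zero _ _ _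
  | succ n ih => exact (integrable_zero _ _ _).sup (hf.add (hT.integrable_comp_of_integrable ih))

lemma setIntegral_maxBirkhoffSum_pos_nonneg (hT : MeasurePreserving T P P) (hfm : Measurable f)
    (hf : Integrable f P) (n : ℕ) : 0 ≤ ∫ x in {x | 0 < maxBirkhoffSum T f n x}, f x ∂P := by
  have hmeas : MeasurableSet {x | 0 < maxBirkhoffSum T f n x} :=
    measurableSet_lt measurable_const (measurable_maxBirkhoffSum hT.measurable hfm n)
  have hi := integrable_maxBirkhoffSum hT hf n
  have hiT : Integrable (fun x => maxBirkhoffSum T f n (T x)) P :=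
    hT.integrable_comp_of_integrable hi
  have h0 : ∫ x, (maxBirkhoffSum T f n x - maxBirkhoffSum T f n (T x)) ∂P = 0 := by
    have h1 : ∫ x, maxBirkhoffSum T f n (T x) ∂P = ∫ x, maxBirkhoffSum T f n x ∂P := by
      have := integral_map (μ := P) hT.measurable.aemeasurable (f := maxBirkhoffSum T f n)
        (by rw [hT.map_eq]; exact hi.aestronglyMeasurable)
      rw [hT.map_eq] at this
      exact this.symm
    rw [integral_sub hi hiT, h1, sub_self]
  rw [← integral_indicator hmeas]
  refine h0.ge.trans (integral_mono (hi.sub hiT) (hf.indicator hmeas) fun x => ?_)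
  have hx := maxBirkhoffSum_nonneg T f n (T x)
  by_cases h : 0 < maxBirkhoffSum T f n x
  · rw [Set.indicator_of_mem (by exact h)]
    cases n with
    | zero => exact absurd h (lt_irrefl _)
    | succ n =>
      have h2 : maxBirkhoffSum T f (n + 1) x = f x + maxBirkhoffSum T f n (T x) := by
        rw [maxBirkhoffSum] at h ⊢
        exact max_eq_right ((lt_max_iff.1 h).resolve_left (lt_irrefl _)).le
      have := maxBirkhoffSum_le_succ T f n (T x)
      simp only
      linarith
  · rw [Set.indicator_of_notMem (by exact h)]
    have := maxBirkhoffSum_nonneg T f n x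
    simp only
    linarith

/-- The maximal ergodic theorem. -/
lemma setIntegral_exists_birkhoffSum_pos_nonneg (hT : MeasurePreserving T P P)
    (hfm : Measurable f) (hf : Integrable f P) :
    0 ≤ ∫ x in {x | ∃ n, 0 < birkhoffSum T f n x}, f x ∂P := by
  have hE : {x | ∃ n, 0 < birkhoffSum T f n x} = ⋃ n, {x | 0 < maxBirkhoffSum T f n x} := by
    ext x
    simp only [Set.mem_ofPred_eq, Set.mem_iUnion]
    constructor
    · rintro ⟨n, hn⟩
      exact ⟨n, hn.trans_le (birkhoffSum_le_maxBirkhoffSum _ _ _ _)⟩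
    · rintro ⟨n, hn⟩
      obtain ⟨k, hk⟩ := exists_maxBirkhoffSum_eq T f n x
      exact ⟨k, hk ▸ hn⟩
  rw [hE]
  refine ge_of_tendsto' (tendsto_setIntegral_of_monotone (fun n => ?_)
    (monotone_nat_of_le_succ fun n x hx => ?_) hf.integrableOn)
    (setIntegral_maxBirkhoffSum_pos_nonneg hT hfm hf)
  · exact measurableSet_lt measurable_const (measurable_maxBirkhoffSum hT.measurable hfm n)
  · exact lt_of_lt_of_le hx (maxBirkhoffSum_le_succ T f n x)

lemma measurable_birkhoffSum (hT : Measurable T) (hf : Measurable f) (n : ℕ) :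
    Measurable (birkhoffSum T f n) :=
  Finset.measurable_fun_sum _ fun k _ => hf.comp (hT.iterate k)

lemma measurable_birkhoffAverage (hT : Measurable T) (hf : Measurable f) (n : ℕ) :
    Measurable (birkhoffAverage ℝ T f n) :=
  (measurable_birkhoffSum hT hf n).const_smul (n : ℝ)⁻¹

/-- The weak type maximal inequality. -/
lemma mul_measureReal_exists_lt_birkhoffSum_le [IsFiniteMeasure P] (hT : MeasurePreserving T P P)
    (hfm : Measurable f) (hf : Integrable f P) (h0 : ∀ x, 0 ≤ f x) (δ : ℝ) :
    δ * P.real {x | ∃ n : ℕ, n * δ < birkhoffSum T f n x} ≤ ∫ x, f x ∂P := by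
  have h := setIntegral_exists_birkhoffSum_pos_nonneg hT (hfm.sub_const δ)
    (hf.sub (integrable_const δ))
  simp only [birkhoffSum_sub_const, sub_pos] at h
  rw [integral_sub hf.integrableOn (integrable_const δ), setIntegral_const, smul_eq_mul] at h
  have h2 := setIntegral_le_integral (s := {x | ∃ n : ℕ, n * δ < birkhoffSum T f n x}) hf
    (Eventually.of_forall h0)
  linarith

lemma invSigma_le (T : Ω → Ω) : invSigma T ≤ ‹MeasurableSpace Ω› := fun _ h => h.1

lemma ae_not_frequently_lt_birkhoffAverage [IsProbabilityMeasure P]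
    (hT : MeasurePreserving T P P) (hfm : Measurable f) {C : ℝ} (hC : ∀ x, |f x| ≤ C)
    (hcond : P[f | invSigma T] =ᵐ[P] 0) {δ : ℝ} (hδ : 0 < δ) :
    ∀ᵐ x ∂P, ∀ k : ℕ, ¬ ∃ᶠ n in atTop, δ + 1 / (k + 1 : ℝ) < birkhoffAverage ℝ T f n x := by
  have hf : Integrable f P := .of_bound hfm.aestronglyMeasurable C (Eventually.of_forall hC)
  set E : Set Ω := {x | ∃ k : ℕ, ∃ᶠ n in atTop, δ + 1 / (k + 1 : ℝ) < birkhoffAverage ℝ T f n x}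
    with hE
  have hEmeas : MeasurableSet E := by
    simp only [hE, frequently_atTop, Set.ofPred_exists, Set.ofPred_forall]
    refine .iUnion fun k => .iInter fun a => .iUnion fun b => ?_
    exact (MeasurableSet.const _).inter
      (measurableSet_lt measurable_const (measurable_birkhoffAverage hT.measurable hfm b))
  have hshift : ∀ u v : ℕ → ℝ, Tendsto (fun n => u n - v n) atTop (nhds 0) →
      (∃ k : ℕ, ∃ᶠ n in atTop, δ + 1 / (k + 1 : ℝ) < u n) →
      ∃ k : ℕ, ∃ᶠ n in atTop, δ + 1 / (k + 1 : ℝ) < v n := by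
    rintro u v huv ⟨k, hk⟩
    refine ⟨2 * k + 1, (hk.and_eventually
      (huv.eventually_lt_const (show (0 : ℝ) < 1 / (2 * k + 2) by positivity))).mono
      fun n hn => ?_⟩
    have e : 1 / (k + 1 : ℝ) = 2 * (1 / (2 * k + 2)) := by field_simp
    have e2 : ((2 * k + 1 : ℕ) : ℝ) + 1 = 2 * k + 2 := by push_cast; ring
    rw [e2]
    rw [e] at hn
    linarith [hn.1, hn.2]
  have hsub : ∀ x, Tendsto (fun n => birkhoffAverage ℝ T f n (T x) - birkhoffAverage ℝ T f n x)
      atTop (nhds 0) := fun x =>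
    tendsto_birkhoffAverage_apply_sub_birkhoffAverage' ℝ
      (isBounded_iff_forall_norm_le.2 ⟨C, by rintro _ ⟨y, rfl⟩; exact hC y⟩) T x
  have hinv : T ⁻¹' E = E := by
    ext x
    refine ⟨hshift _ _ (hsub x), hshift _ _ ?_⟩
    simpa using (hsub x).neg
  have hiter : ∀ x (k : ℕ), T^[k] x ∈ E ↔ x ∈ E := fun x k => by
    induction k with
    | zero => simp
    | succ k ih =>
      rw [Function.iterate_succ_apply', ← ih]
      exact Set.ext_iff.1 hinv _
  have hsum : ∀ n x, birkhoffSum T (E.indicator fun y => f y - δ) n x =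
      E.indicator (fun y => birkhoffSum T f n y - n * δ) x := fun n x => by
    by_cases hx : x ∈ E
    · rw [Set.indicator_of_mem hx, ← birkhoffSum_sub_const]
      exact Finset.sum_congr rfl fun k _ => Set.indicator_of_mem ((hiter x k).2 hx) _
    · rw [Set.indicator_of_notMem hx]
      exact Finset.sum_eq_zero fun k _ => Set.indicator_of_notMem (fun h => hx ((hiter x k).1 h)) _
  have hset : {x | ∃ n, 0 < birkhoffSum T (E.indicator fun y => f y - δ) n x} = E := by
    ext x
    simp only [Set.mem_ofPred_eq, hsum]
    constructor
    · rintro ⟨n, hn⟩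
      by_contra hx
      rw [Set.indicator_of_notMem hx] at hn
      exact lt_irrefl _ hn
    · intro hx
      obtain ⟨k, hk⟩ := hx
      obtain ⟨n, hn, hn0⟩ := (hk.and_eventually (eventually_gt_atTop 0)).exists
      refine ⟨n, ?_⟩
      rw [Set.indicator_of_mem (show x ∈ E from ⟨k, hk⟩)]
      have hn' : (0 : ℝ) < n := by exact_mod_cast hn0
      have h1 : δ < birkhoffAverage ℝ T f n x := by
        have : 0 < 1 / (k + 1 : ℝ) := by positivity
        linarith
      rw [birkhoffAverage, smul_eq_mul, inv_mul_eq_div, lt_div_iff₀ hn'] at h1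
      linarith
  have hmax := setIntegral_exists_birkhoffSum_pos_nonneg hT
    ((hfm.sub_const δ).indicator hEmeas) ((hf.sub (integrable_const δ)).indicator hEmeas)
  rw [hset, setIntegral_indicator hEmeas, Set.inter_self, integral_sub hf.integrableOn
    (integrable_const δ), setIntegral_const, smul_eq_mul,
    ← setIntegral_condExp (invSigma_le T) hf (show MeasurableSet[invSigma T] E from ⟨hEmeas, hinv⟩),
    integral_congr_ae (ae_restrict_of_ae hcond)] at hmax
  simp only [Pi.zero_apply, integral_zero, zero_sub, Left.nonneg_neg_iff] at hmax
  have hP : P.real E = 0 :=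
    le_antisymm (nonpos_of_mul_nonpos_left hmax hδ) measureReal_nonneg
  rw [measureReal_eq_zero_iff] at hP
  filter_upwards [measure_eq_zero_iff_ae_notMem.1 hP] with x hx k hk using hx ⟨k, hk⟩

/-- Birkhoff's pointwise ergodic theorem for bounded functions with vanishing invariant part. -/
lemma ae_tendsto_birkhoffAverage_zero [IsProbabilityMeasure P]
    (hT : MeasurePreserving T P P) (hfm : Measurable f) {C : ℝ} (hC : ∀ x, |f x| ≤ C)
    (hcond : P[f | invSigma T] =ᵐ[P] 0) :
    ∀ᵐ x ∂P, Tendsto (fun n => birkhoffAverage ℝ T f n x) atTop (nhds 0) := by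
  have hcond' : P[-f | invSigma T] =ᵐ[P] 0 := by
    filter_upwards [condExp_neg f (invSigma T) (μ := P), hcond] with x h1 h2
    rw [h1, Pi.neg_apply, h2, Pi.zero_apply, neg_zero]
  have h1 := ae_all_iff.2 fun m : ℕ => ae_not_frequently_lt_birkhoffAverage hT hfm hC hcond
    (show (0 : ℝ) < 1 / (m + 1) by positivity)
  have h2 := ae_all_iff.2 fun m : ℕ => ae_not_frequently_lt_birkhoffAverage hT hfm.neg
    (fun x => by rw [Pi.neg_apply, abs_neg]; exact hC x) hcond'
    (show (0 : ℝ) < 1 / (m + 1) by positivity)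
  filter_upwards [h1, h2] with x h1 h2
  rw [Metric.tendsto_atTop']
  intro ε hε
  obtain ⟨m, hm⟩ := exists_nat_one_div_lt (half_pos hε)
  have h3 := not_frequently.1 (h1 m m)
  have h4 := not_frequently.1 (h2 m m)
  obtain ⟨N, hN⟩ := eventually_atTop.1 (h3.and h4)
  refine ⟨N, fun n hn => ?_⟩
  obtain ⟨h5, h6⟩ := hN n hn.le
  rw [birkhoffAverage_neg] at h6
  rw [Real.dist_eq, sub_zero, abs_lt]
  simp only [Pi.neg_apply, not_lt] at h5 h6
  constructor <;> linarith

lemma ae_tendsto_birkhoffAverage_of_ae_tendsto_zero [IsProbabilityMeasure P]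
    (hT : MeasurePreserving T P P) {F : ℕ → Ω → ℝ} (hFm : ∀ n, Measurable (F n))
    (hF0 : ∀ n x, 0 ≤ F n x) {C : ℝ} (hC : ∀ n x, F n x ≤ C)
    (hF : ∀ᵐ x ∂P, Tendsto (fun n => F n x) atTop (nhds 0)) :
    ∀ᵐ x ∂P, Tendsto (fun n => birkhoffAverage ℝ T (F n) n x) atTop (nhds 0) := by
  have key : ∀ ε : ℝ, 0 < ε →
      ∀ᵐ x ∂P, ∀ᶠ n in atTop, birkhoffAverage ℝ T (F n) n x ≤ ε + C * ε := by
    intro ε hε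
    rw [ae_iff]
    refine le_antisymm (ENNReal.le_of_forall_pos_le_add fun κ hκ _ => ?_) zero_le
    rw [zero_add]
    obtain ⟨t, htm, htP, ht⟩ := tendstoUniformlyOn_of_ae_tendsto' (μ := P) (f := F)
      (g := fun _ => 0) (fun n => (hFm n).stronglyMeasurable) stronglyMeasurable_zero hF
      (mul_pos hε (show (0 : ℝ) < κ from hκ))
    have hweak := mul_measureReal_exists_lt_birkhoffSum_le hT (measurable_const.indicator htm)
      ((integrable_const (1 : ℝ)).indicator htm)
      (fun x => Set.indicator_nonneg (fun _ _ => zero_le_one) x) ε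
    set W := {x | ∃ n : ℕ, n * ε < birkhoffSum T (t.indicator fun _ => (1 : ℝ)) n x}
    have hW : P.real W ≤ κ := by
      rw [integral_indicator htm, setIntegral_const, smul_eq_mul, mul_one] at hweak
      have : P.real t ≤ ε * κ := ENNReal.toReal_le_of_le_ofReal (by positivity) htP
      exact le_of_mul_le_mul_left (hweak.trans this) hε
    have hW' : P W ≤ κ := by
      rw [← ENNReal.ofReal_coe_nnreal]
      rw [← ofReal_measureReal]
      exact ENNReal.ofReal_le_ofReal hW
    refine (measure_mono fun x hx => ?_).trans hW'
    by_contra hxW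
    refine hx ?_
    filter_upwards [Metric.tendstoUniformlyOn_iff.1 ht ε hε, eventually_gt_atTop 0] with n hn hn0
    have hn' : (0 : ℝ) < n := by exact_mod_cast hn0
    have hx2 : birkhoffSum T (t.indicator fun _ => (1 : ℝ)) n x ≤ n * ε :=
      not_lt.1 fun h => hxW ⟨n, h⟩
    have hC0 : 0 ≤ C := (hF0 n x).trans (hC n x)
    have hle : birkhoffSum T (F n) n x ≤
        n * ε + C * birkhoffSum T (t.indicator fun _ => (1 : ℝ)) n x := by
      have e : (n : ℝ) * ε = ∑ k ∈ Finset.range n, ε := by simp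
      rw [birkhoffSum, birkhoffSum, e, Finset.mul_sum, ← Finset.sum_add_distrib]
      refine Finset.sum_le_sum fun k _ => ?_
      by_cases hk : T^[k] x ∈ t
      · rw [Set.indicator_of_mem hk]
        linarith [hC n (T^[k] x)]
      · rw [Set.indicator_of_notMem hk]
        have := hn _ hk
        rw [Real.dist_eq, zero_sub, abs_neg, abs_of_nonneg (hF0 _ _)] at this
        linarith
    rw [birkhoffAverage, smul_eq_mul, inv_mul_eq_div, div_le_iff₀ hn']
    have := mul_le_mul_of_nonneg_left hx2 hC0
    linarith
  have h1 := ae_all_iff.2 fun m : ℕ => key (1 / (m + 1)) (by positivity)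
  filter_upwards [h1] with x hx
  have hlim : Tendsto (fun m : ℕ => 1 / (m + 1 : ℝ) + C * (1 / (m + 1))) atTop (nhds 0) := by
    have := tendsto_one_div_add_atTop_nhds_zero_nat (𝕜 := ℝ)
    simpa using this.add (this.const_mul C)
  refine tendsto_order.2 ⟨fun a ha => Eventually.of_forall fun n => ha.trans_le ?_, fun a ha => ?_⟩
  · rw [birkhoffAverage, smul_eq_mul]
    exact mul_nonneg (by positivity) (Finset.sum_nonneg fun k _ => hF0 _ _)
  · obtain ⟨m, hm⟩ := (hlim.eventually_lt_const ha).exists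
    filter_upwards [hx m] with n hn using hn.trans_lt hm

/-- Averaging over one map the absolute Birkhoff averages of another one. -/
lemma ae_tendsto_sum_abs_sum_zero [IsProbabilityMeasure P] {S : Ω → Ω}
    (hS : MeasurePreserving S P P) (hT : MeasurePreserving T P P) (hfm : Measurable f) {C : ℝ}
    (hC : ∀ x, |f x| ≤ C) (hcond : P[f | invSigma T] =ᵐ[P] 0) :
    ∀ᵐ x ∂P, Tendsto (fun n : ℕ => (∑ i : Fin n, |∑ j : Fin n, f (T^[j] (S^[i] x))|) / n / n)
      atTop (nhds 0) := by
  have h := ae_tendsto_birkhoffAverage_of_ae_tendsto_zero hS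
    (F := fun n x => |birkhoffAverage ℝ T f n x|) (C := C)
    (fun n => (measurable_birkhoffAverage hT.measurable hfm n).abs)
    (fun n x => abs_nonneg _) (fun n x => ?_) ?_
  · filter_upwards [h] with x hx
    refine hx.congr fun n => ?_
    simp only [birkhoffAverage, birkhoffSum, smul_eq_mul, abs_mul, abs_inv, Nat.abs_cast,
      ← Finset.mul_sum, Finset.sum_range]
    ring
  · have hC0 : 0 ≤ C := (abs_nonneg _).trans (hC x)
    rcases Nat.eq_zero_or_pos n with rfl | hn
    · simpa using hC0
    have hn' : (0 : ℝ) < n := by exact_mod_cast hn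
    rw [birkhoffAverage, smul_eq_mul, abs_mul, abs_inv, Nat.abs_cast, inv_mul_le_iff₀ hn']
    refine (Finset.abs_sum_le_sum_abs _ _).trans ((Finset.sum_le_sum fun k _ => hC _).trans ?_)
    simp
  · filter_upwards [ae_tendsto_birkhoffAverage_zero hT hfm hC hcond] with x hx
    simpa using hx.abs

end MaximalErgodic

/-- law of large permanent for doubly stochastic functions. -/
theorem llp_doubly_stochastic
    {Ω : Type*} [MeasurableSpace Ω] (P : Measure Ω) [IsProbabilityMeasure P]
    (S T : Ω → Ω) (hS : MeasurePreserving S P P) (hT : MeasurePreserving T P P)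
    (hST : S ∘ T = T ∘ S)
    (herg : ∀ A : Set Ω, MeasurableSet A → S ⁻¹' A = A → T ⁻¹' A = A →
      P A = 0 ∨ P A = 1)
    (g : Ω → ℝ) (hg : Measurable g)
    (lam : ℝ) (hlam : 1 ≤ lam) (hbd : ∀ᵐ ω ∂P, lam⁻¹ ≤ g ω ∧ g ω ≤ lam)
    (hds1 : P[g | invSigma S] =ᵐ[P] fun _ => 1)
    (hds2 : P[g | invSigma T] =ᵐ[P] fun _ => 1) :
    ∀ᵐ ω ∂P, Tendsto
      (fun n : ℕ => permMean (Matrix.of fun i j : Fin n => g (S^[(i : ℕ)] (T^[(j : ℕ)] ω))))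
      atTop (nhds 1) := by
  have hl0 : 0 < lam := by linarith
  have hli : lam⁻¹ ≤ lam := (inv_le_one_of_one_le₀ hlam).trans hlam
  have hcomm : ∀ i j x, S^[i] (T^[j] x) = T^[j] (S^[i] x) := fun i j x =>
    ((Function.Commute.iterate_iterate (fun y => congrFun hST y) i j) x)
  set h : Ω → ℝ := fun x => max lam⁻¹ (min (g x) lam)
  have hhm : Measurable h := measurable_const.max (hg.min measurable_const)
  have hhb : ∀ x, lam⁻¹ ≤ h x ∧ h x ≤ lam := fun x =>
    ⟨le_max_left _ _, max_le hli (min_le_right _ _)⟩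
  have hgh : ∀ᵐ x ∂P, g x = h x := by
    filter_upwards [hbd] with x hx
    simp [h, hx.1, hx.2]
  have hC : ∀ x, |h x - 1| ≤ lam := fun x => by
    have := inv_pos.2 hl0
    exact abs_le.2 ⟨by linarith [(hhb x).1], by linarith [(hhb x).2]⟩
  have hint : Integrable h P := .of_bound hhm.aestronglyMeasurable lam (Eventually.of_forall
    fun x => by
      rw [Real.norm_of_nonneg ((inv_pos.2 hl0).le.trans (hhb x).1)]
      exact (hhb x).2)
  have hcond : ∀ U : Ω → Ω, P[g | invSigma U] =ᵐ[P] (fun _ => 1) →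
      P[fun x => h x - 1 | invSigma U] =ᵐ[P] 0 := fun U hU => by
    filter_upwards [condExp_sub hint (integrable_const (1 : ℝ)) (invSigma U),
      condExp_congr_ae (m := invSigma U) hgh, hU] with x h1 h2 h3
    change P[h - fun _ => (1 : ℝ) | invSigma U] x = 0
    rw [h1, Pi.sub_apply, ← h2, h3, condExp_const (invSigma_le U), sub_self]
  have horb : ∀ᵐ x ∂P, ∀ i j : ℕ, g (S^[i] (T^[j] x)) = h (S^[i] (T^[j] x)) :=
    ae_all_iff.2 fun i => ae_all_iff.2 fun j =>
      ((hS.iterate i).comp (hT.iterate j)).quasiMeasurePreserving.ae hgh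
  filter_upwards [horb,
    ae_tendsto_sum_abs_sum_zero hS hT (hhm.sub_const 1) hC (hcond T hds2),
    ae_tendsto_sum_abs_sum_zero hT hS (hhm.sub_const 1) hC (hcond S hds1)] with x hx hr hc
  simp only [hx]
  refine tendsto_permMean (fun n => Matrix.of fun i j : Fin n => h (S^[(i : ℕ)] (T^[(j : ℕ)] x)))
    hlam (fun n i j => hhb _) (hr.congr fun n => ?_) (hc.congr fun n => ?_)
  · simp [hcomm]
  · simp
end
end

section
/- Let λ > 1. There exists ε₀ = ε₀(λ) > 0 such that for every ε with 0 < ε ≤ ε₀ the following holds. Let X_n = (x_{ij}) be an n×n real matrix with λ⁻¹ ≤ x_{ij} ≤ λ for all i, j, such that the number of rows whose sum lies outside [(1−ε)n, (1+ε)n] is at most εn and the number of columns whose sum lies outside [(1−ε)n, (1+ε)n] is at most εn. Then there exists an n×n matrix X'_n = (x'_{ij}) ∈ n·Ω_n such that (2λ)⁻¹ ≤ x'_{ij} ≤ 2λ for all i, j and ∑_{1≤i,j≤n} |x_{ij} − x'_{ij}| ≤ 16ελ²n². -/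
noncomputable section

/-- If all row and column sums of `Y` are within `δ * n` of `n`, then changing every entry by at
most `3 * δ` makes all of them equal to `n`. -/
theorem exists_line_sums_eq_of_abs_sub_le {n : ℕ} {δ : ℝ} (Y : Matrix (Fin n) (Fin n) ℝ)
    (hrow : ∀ i, |n - ∑ j, Y i j| ≤ δ * n) (hcol : ∀ j, |n - ∑ i, Y i j| ≤ δ * n) :
    ∃ Z : Matrix (Fin n) (Fin n) ℝ, (∀ i, ∑ j, Z i j = n) ∧ (∀ j, ∑ i, Z i j = n) ∧
      ∀ i j, |Z i j - Y i j| ≤ 3 * δ := by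
  obtain rfl | hpos := Nat.eq_zero_or_pos n
  · exact ⟨Y, fun i => i.elim0, fun j => j.elim0, fun i => i.elim0⟩
  have hn : (0 : ℝ) < n := by exact_mod_cast hpos
  set r : Fin n → ℝ := fun i => n - ∑ j, Y i j with hr
  set c : Fin n → ℝ := fun j => n - ∑ i, Y i j with hc
  have hrc : ∑ j, c j = ∑ i, r i := by
    simp only [hr, hc, Finset.sum_sub_distrib]
    rw [Finset.sum_comm]
  have hS : |∑ i, r i| ≤ δ * n * n := by
    calc |∑ i, r i| ≤ ∑ i, |r i| := Finset.abs_sum_le_sum_abs _ _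
      _ ≤ ∑ _i : Fin n, δ * n := Finset.sum_le_sum fun i _ => hrow i
      _ = δ * n * n := by simp [mul_comm]
  refine ⟨fun i j => Y i j + (r i / n + c j / n - (∑ k, r k) / n ^ 2), fun i => ?_, fun j => ?_,
    fun i j => ?_⟩
  · have h : ∑ j, Y i j = n - r i := by simp [hr]
    simp only [Finset.sum_add_distrib, Finset.sum_sub_distrib, ← Finset.sum_div, hrc, h,
      Finset.sum_const, Finset.card_univ, Fintype.card_fin, nsmul_eq_mul]
    field_simp
    ring
  · have h : ∑ i, Y i j = n - c j := by simp [hc]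
    simp only [Finset.sum_add_distrib, Finset.sum_sub_distrib, ← Finset.sum_div, h,
      Finset.sum_const, Finset.card_univ, Fintype.card_fin, nsmul_eq_mul]
    field_simp
    ring
  · have h1 : |r i / n| ≤ δ := by
      rw [abs_div, abs_of_pos hn, div_le_iff₀ hn]
      exact hrow i
    have h2 : |c j / n| ≤ δ := by
      rw [abs_div, abs_of_pos hn, div_le_iff₀ hn]
      exact hcol j
    have h3 : |(∑ k, r k) / n ^ 2| ≤ δ := by
      rw [abs_div, abs_of_pos (pow_pos hn 2), div_le_iff₀ (pow_pos hn 2)]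
      linarith
    rw [add_sub_cancel_left]
    rw [abs_le] at *
    constructor <;> linarith [h1.1, h1.2, h2.1, h2.2, h3.1, h3.2]

theorem abs_sub_one_le_of_inv_le {L x : ℝ} (hL : 1 < L) (h₁ : L⁻¹ ≤ x) (h₂ : x ≤ L) :
    |x - 1| ≤ L - 1 := by
  have h : 2 - L ≤ L⁻¹ := by
    rw [← one_div, le_div_iff₀ (by linarith)]
    nlinarith [sq_nonneg (L - 1)]
  rw [abs_le]
  constructor <;> linarith

/-- Replacing at most `ε * n` entries of a vector with entries in `[L⁻¹, L]` by `1` moves its sum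
by at most `ε * (L - 1) * n`. -/
theorem abs_sub_sum_ite_one_le {n : ℕ} {ε L : ℝ} (hL : 1 < L) (x : Fin n → ℝ)
    (hx : ∀ j, L⁻¹ ≤ x j ∧ x j ≤ L) (C : Finset (Fin n)) (hC : (C.card : ℝ) ≤ ε * n)
    (hsum : (1 - ε) * n ≤ ∑ j, x j ∧ ∑ j, x j ≤ (1 + ε) * n) :
    |n - ∑ j, (if j ∈ C then 1 else x j)| ≤ ε * L * n := by
  have h : |∑ j, x j - ∑ j, (if j ∈ C then 1 else x j)| ≤ C.card * (L - 1) := by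
    rw [← Finset.sum_sub_distrib]
    calc _ ≤ ∑ j, |x j - (if j ∈ C then 1 else x j)| := Finset.abs_sum_le_sum_abs _ _
      _ ≤ ∑ j, if j ∈ C then L - 1 else 0 := Finset.sum_le_sum fun j _ => by
        split_ifs
        · exact abs_sub_one_le_of_inv_le hL (hx j).1 (hx j).2
        · simp
      _ = C.card * (L - 1) := by simp [mul_sub]
  have h' : C.card * (L - 1) ≤ ε * n * (L - 1) :=
    mul_le_mul_of_nonneg_right hC (by linarith)
  rw [abs_le] at *
  constructor <;> linarith [h.1, h.2, hsum.1, hsum.2]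

/-- a matrix with bounded entries whose row and column sums are mostly
close to `n` can be approximated in `L¹` by a matrix in `n·Ω_n` with bounded entries. -/
theorem approx_by_scaled_doubly_stochastic (lam : ℝ) (hlam : 1 < lam) :
    ∃ ε₀ : ℝ, 0 < ε₀ ∧ ∀ ε : ℝ, 0 < ε → ε ≤ ε₀ →
      ∀ (n : ℕ) (X : Matrix (Fin n) (Fin n) ℝ),
        (∀ i j, lam⁻¹ ≤ X i j ∧ X i j ≤ lam) →
        ((Finset.univ.filter fun i : Fin n =>
            ¬((1 - ε) * n ≤ ∑ j, X i j ∧ (∑ j, X i j) ≤ (1 + ε) * n)).card : ℝ) ≤ ε * n →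
        ((Finset.univ.filter fun j : Fin n =>
            ¬((1 - ε) * n ≤ ∑ i, X i j ∧ (∑ i, X i j) ≤ (1 + ε) * n)).card : ℝ) ≤ ε * n →
        ∃ X' : Matrix (Fin n) (Fin n) ℝ,
          (∀ i j, (2 * lam)⁻¹ ≤ X' i j ∧ X' i j ≤ 2 * lam) ∧
          (∀ i, ∑ j, X' i j = n) ∧ (∀ j, ∑ i, X' i j = n) ∧
          (∑ i, ∑ j, |X i j - X' i j|) ≤ 16 * ε * lam ^ 2 * n ^ 2 := by
  have hL0 : 0 < lam := by linarith
  refine ⟨1 / (6 * lam ^ 2), by positivity, fun ε hε hε₀ n X hX hR hC => ?_⟩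
  set R := Finset.univ.filter fun i : Fin n =>
    ¬((1 - ε) * n ≤ ∑ j, X i j ∧ (∑ j, X i j) ≤ (1 + ε) * n) with hRdef
  set C := Finset.univ.filter fun j : Fin n =>
    ¬((1 - ε) * n ≤ ∑ i, X i j ∧ (∑ i, X i j) ≤ (1 + ε) * n) with hCdef
  have hδn : 0 ≤ ε * lam * n := by positivity
  let Y : Matrix (Fin n) (Fin n) ℝ := fun i j => if i ∈ R then 1 else if j ∈ C then 1 else X i j
  have hrow : ∀ i, |n - ∑ j, Y i j| ≤ ε * lam * n := fun i => by
    by_cases hi : i ∈ R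
    · simpa [Y, hi] using hδn
    · simp only [Y, if_neg hi]
      exact abs_sub_sum_ite_one_le hlam (X i) (hX i) C hC (by simpa [hRdef] using hi)
  have hcol : ∀ j, |n - ∑ i, Y i j| ≤ ε * lam * n := fun j => by
    by_cases hj : j ∈ C
    · simpa [Y, hj] using hδn
    · simp only [Y, if_neg hj]
      exact abs_sub_sum_ite_one_le hlam (fun i => X i j) (fun i => hX i j) R hR
        (by simpa [hCdef] using hj)
  obtain ⟨Z, hZrow, hZcol, hZY⟩ := exists_line_sums_eq_of_abs_sub_le Y hrow hcol
  have hYbd : ∀ i j, lam⁻¹ ≤ Y i j ∧ Y i j ≤ lam := fun i j => by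
    have h1 : lam⁻¹ ≤ 1 := inv_le_one_of_one_le₀ hlam.le
    simp only [Y]
    split_ifs
    exacts [⟨h1, hlam.le⟩, ⟨h1, hlam.le⟩, hX i j]
  have hXY : ∀ i j, |X i j - Y i j| ≤
      (if i ∈ R then lam - 1 else 0) + (if j ∈ C then lam - 1 else 0) := fun i j => by
    have h1 := abs_sub_one_le_of_inv_le hlam (hX i j).1 (hX i j).2
    simp only [Y]
    split_ifs <;> simp <;> linarith
  have hsmall : 3 * (ε * lam) ≤ (2 * lam)⁻¹ := by
    rw [le_div_iff₀ (by positivity)] at hε₀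
    rw [← one_div, le_div_iff₀ (by positivity)]
    linarith
  have hhalf : lam⁻¹ = 2 * (2 * lam)⁻¹ := by
    field_simp
  have hinv : lam⁻¹ ≤ lam := (inv_le_one_of_one_le₀ hlam.le).trans hlam.le
  refine ⟨Z, fun i j => ?_, hZrow, hZcol, ?_⟩
  · have h := abs_le.1 (hZY i j)
    have hY := hYbd i j
    constructor <;> linarith [h.1, h.2, hY.1, hY.2]
  calc ∑ i, ∑ j, |X i j - Z i j|
      ≤ ∑ i, ∑ j, ((if i ∈ R then lam - 1 else 0) + (if j ∈ C then lam - 1 else 0)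
          + 3 * (ε * lam)) :=
        Finset.sum_le_sum fun i _ => Finset.sum_le_sum fun j _ =>
          (abs_sub_le _ (Y i j) _).trans
            (add_le_add (hXY i j) (by rw [abs_sub_comm]; exact hZY i j))
    _ = (R.card + C.card) * ((lam - 1) * n) + 3 * (ε * lam) * n ^ 2 := by
        simp only [Finset.sum_add_distrib, Finset.sum_const, Finset.card_univ, Fintype.card_fin,
          nsmul_eq_mul, Finset.sum_ite_mem, Finset.univ_inter, ← Finset.mul_sum]
        ring
    _ ≤ (ε * n + ε * n) * ((lam - 1) * n) + 3 * (ε * lam) * n ^ 2 := by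
        have : 0 ≤ (lam - 1) * n := mul_nonneg (by linarith) n.cast_nonneg
        gcongr
    _ = ε * (5 * lam - 2) * n ^ 2 := by ring
    _ ≤ ε * (16 * lam ^ 2) * n ^ 2 := by
        gcongr
        nlinarith
    _ = 16 * ε * lam ^ 2 * n ^ 2 := by ring
end
end

section
/- Let λ > 1. There exists ε₀ = ε₀(λ) > 0 such that for every ε with 0 < ε ≤ ε₀ the following holds. Let Y_m = (y_{ij}) be an m×m real matrix such that (2λ)⁻¹ ≤ y_{ij} ≤ 2λ for all i, j, every row sum equals exactly m, and every column sum lies in the interval [(1−4λε)m, (1+4λε)m]. Then there exists a matrix Y'_m = (y'_{ij}) ∈ m·Ω_m such that ∑_{1≤i,j≤m} |y_{ij} − y'_{ij}| ≤ 4ελ²m². -/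
noncomputable section

/-- a matrix with bounded entries, exact row sums `m` and column sums close
to `m` can be approximated in `L¹` by a matrix in `m·Ω_m`. -/
theorem approx_by_scaled_doubly_stochastic_exact_rows (lam : ℝ) (hlam : 1 < lam) :
    ∃ ε₀ : ℝ, 0 < ε₀ ∧ ∀ ε : ℝ, 0 < ε → ε ≤ ε₀ →
      ∀ (m : ℕ) (Y : Matrix (Fin m) (Fin m) ℝ),
        (∀ i j, (2 * lam)⁻¹ ≤ Y i j ∧ Y i j ≤ 2 * lam) →
        (∀ i, ∑ j, Y i j = m) →
        (∀ j, (1 - 4 * lam * ε) * m ≤ ∑ i, Y i j ∧ (∑ i, Y i j) ≤ (1 + 4 * lam * ε) * m) →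
        ∃ Y' : Matrix (Fin m) (Fin m) ℝ,
          (∀ i j, 0 ≤ Y' i j) ∧
          (∀ i, ∑ j, Y' i j = m) ∧ (∀ j, ∑ i, Y' i j = m) ∧
          (∑ i, ∑ j, |Y i j - Y' i j|) ≤ 4 * ε * lam ^ 2 * m ^ 2 := by
  have hl : 0 < lam := by linarith
  refine ⟨(2 * lam)⁻¹ / (4 * lam), by positivity, fun ε hε hε₀ m Y hY hrow hcol => ?_⟩
  rw [le_div_iff₀ (by positivity)] at hε₀
  have hdev : ∀ j, |(m - ∑ k, Y k j) / m| ≤ 4 * lam * ε := fun j => by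
    have hm : (0 : ℝ) < m := by exact_mod_cast j.pos
    rw [abs_div, abs_of_pos hm, div_le_iff₀ hm, abs_le]
    constructor <;> linarith [hcol j]
  refine ⟨fun i j => Y i j + (m - ∑ k, Y k j) / m, fun i j => ?_, fun i => ?_, fun j => ?_, ?_⟩
  · linarith [(hY i j).1, (abs_le.1 (hdev j)).1]
  · have htotal : ∑ j, ∑ k, Y k j = (m : ℝ) * m := by
      rw [Finset.sum_comm]
      simp [hrow]
    rw [Finset.sum_add_distrib, hrow, ← Finset.sum_div, Finset.sum_sub_distrib, htotal]
    simp
  · have hm : (m : ℝ) ≠ 0 := by exact_mod_cast j.pos.ne'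
    rw [Finset.sum_add_distrib, Finset.sum_const, Finset.card_univ, Fintype.card_fin,
      nsmul_eq_mul, mul_div_cancel₀ _ hm]
    ring
  · calc ∑ i, ∑ j, |Y i j - (Y i j + (m - ∑ k, Y k j) / m)|
        ≤ ∑ _i : Fin m, ∑ _j : Fin m, 4 * lam * ε := by
          gcongr with i _ j _
          rw [sub_add_cancel_left, abs_neg]
          exact hdev j
      _ = 4 * ε * lam * (m : ℝ) ^ 2 := by
          simp only [Finset.sum_const, Finset.card_univ, Fintype.card_fin, nsmul_eq_mul]
          ring
      _ ≤ 4 * ε * lam ^ 2 * (m : ℝ) ^ 2 := by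
          gcongr
          nlinarith
end
end
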